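/- arXiv:1709.05504 — 7 statements merged into one kernel-verified Lean document; each statement's English description precedes it below -/
import Mathlib

section
/- Suppose m and n are positive integers with m ≤ n, M is a connected m-dimensional manifold-with-boundary of class C¹, F : M → ℝⁿ is an immersion of class C¹, σ is the intrinsic distance on M induced by F, C is a subset of M, and ℋ^{m−1}_σ( (Bdry C) ∖ ∂M ) = 0, where Bdry C denotes the topological boundary of C in M. Then either ℋ^m_σ(C) = 0 or ℋ^m_σ(M ∖ C) = 0. -/
open Set Metric
open scoped ENNReal Manifold Topology

noncomputable section

abbrev Euc (n : ℕ) : Type := EuclideanSpace ℝ (Fin n)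

/-- Extended diameter of a set with respect to an `ℝ≥0∞`-valued distance function. -/
def ediamWith {X : Type*} (ρ : X → X → ℝ≥0∞) (s : Set X) : ℝ≥0∞ :=
  ⨆ x ∈ s, ⨆ y ∈ s, ρ x y

/-- The `d`-dimensional Hausdorff (outer) measure associated with an `ℝ≥0∞`-valued
distance function `ρ` (same normalisation as Mathlib's `μH[d]`). -/
def hausdorffWith {X : Type*} (ρ : X → X → ℝ≥0∞) (d : ℝ) (S : Set X) : ℝ≥0∞ :=
  ⨆ (δ : ℝ≥0∞) (_ : 0 < δ),
    ⨅ (t : ℕ → Set X) (_ : S ⊆ ⋃ i, t i) (_ : ∀ i, ediamWith ρ (t i) ≤ δ),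
      ∑' i, ⨆ _ : (t i).Nonempty, ediamWith ρ (t i) ^ d

/-- The intrinsic distance on `M` induced by `F : M → ℝⁿ`. -/
def immersionDist {M : Type*} [TopologicalSpace M] {n : ℕ} (F : M → Euc n) (c z : M) : ℝ≥0∞ :=
  ⨅ (C : ℝ → M) (_ : ContinuousOn C (Set.Icc 0 1)) (_ : C 0 = c) (_ : C 1 = z),
    eVariationOn (F ∘ C) (Set.Icc 0 1)

open scoped NNReal

theorem hausdorffWith_eq_zero_iff {X : Type*} {ρ : X → X → ℝ≥0∞} {d : ℝ} {S : Set X} :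
    hausdorffWith ρ d S = 0 ↔ ∀ δ : ℝ≥0∞, 0 < δ → ∀ ε : ℝ≥0∞, 0 < ε →
      ∃ t : ℕ → Set X, S ⊆ ⋃ i, t i ∧ (∀ i, ediamWith ρ (t i) ≤ δ) ∧
        ∑' i, ⨆ _ : (t i).Nonempty, ediamWith ρ (t i) ^ d < ε := by
  simp only [hausdorffWith, ENNReal.iSup_eq_zero]
  refine forall_congr' fun δ => forall_congr' fun _ => ?_
  rw [← bot_eq_zero, iInf_eq_bot]
  simp only [iInf_lt_iff, bot_eq_zero, exists_prop]

theorem hausdorffWith_mono {X : Type*} {ρ : X → X → ℝ≥0∞} {d : ℝ} {S T : Set X} (h : S ⊆ T) :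
    hausdorffWith ρ d S ≤ hausdorffWith ρ d T := by
  refine iSup₂_mono fun δ _ => le_iInf fun t => le_iInf fun ht => ?_
  exact iInf_le_of_le t (iInf_le_of_le (h.trans ht) le_rfl)

theorem hausdorffWith_mono_null {X : Type*} {ρ : X → X → ℝ≥0∞} {d : ℝ} {S T : Set X} (h : S ⊆ T)
    (hT : hausdorffWith ρ d T = 0) : hausdorffWith ρ d S = 0 :=
  le_antisymm ((hausdorffWith_mono h).trans hT.le) bot_le

theorem hausdorffWith_iUnion_null {X : Type*} {ρ : X → X → ℝ≥0∞} {d : ℝ} {S : ℕ → Set X}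
    (h : ∀ k, hausdorffWith ρ d (S k) = 0) : hausdorffWith ρ d (⋃ k, S k) = 0 := by
  simp only [hausdorffWith_eq_zero_iff] at h ⊢
  intro δ hδ ε hε
  obtain ⟨e, he, hsum⟩ := ENNReal.exists_pos_sum_of_countable' hε.ne' ℕ
  choose t ht hdiam hlt using fun k => h k δ hδ (e k) (he k)
  refine ⟨fun i => t (Nat.unpair i).1 (Nat.unpair i).2, ?_, fun i => hdiam _ _, ?_⟩
  · refine iUnion_subset fun k x hx => ?_
    obtain ⟨j, hj⟩ := mem_iUnion.1 (ht k hx)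
    exact mem_iUnion.2 ⟨Nat.pair k j, by simpa using hj⟩
  · refine lt_of_le_of_lt ?_ hsum
    calc _ = ∑' p : ℕ × ℕ, ⨆ _ : (t p.1 p.2).Nonempty, ediamWith ρ (t p.1 p.2) ^ d :=
          Nat.pairEquiv.symm.tsum_eq
            fun p : ℕ × ℕ => ⨆ _ : (t p.1 p.2).Nonempty, ediamWith ρ (t p.1 p.2) ^ d
      _ = ∑' k, ∑' j, ⨆ _ : (t k j).Nonempty, ediamWith ρ (t k j) ^ d := ENNReal.tsum_prod'
      _ ≤ _ := ENNReal.tsum_le_tsum fun k => (hlt k).le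

theorem hausdorffWith_edist {X : Type*} [EMetricSpace X] [MeasurableSpace X] [BorelSpace X]
    (d : ℝ) (S : Set X) : hausdorffWith edist d S = MeasureTheory.Measure.hausdorffMeasure d S :=
  (MeasureTheory.Measure.hausdorffMeasure_apply d S).symm

/-- A map that expands distances at most by a constant factor preserves Hausdorff null sets. -/
theorem hausdorffWith_image_null {X Y : Type*} {ρ : X → X → ℝ≥0∞} {ρ' : Y → Y → ℝ≥0∞}
    {f : X → Y} {S : Set X} {K : ℝ≥0} {d : ℝ} (hd : 0 ≤ d)
    (hf : ∀ x ∈ S, ∀ y ∈ S, ρ' (f x) (f y) ≤ K * ρ x y) (hS : hausdorffWith ρ d S = 0) :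
    hausdorffWith ρ' d (f '' S) = 0 := by
  wlog hK : 0 < K generalizing K
  · refine this (K := 1) (fun x hx y hy => (hf x hx y hy).trans ?_) one_pos
    simp [le_antisymm (not_lt.1 hK) bot_le]
  rw [hausdorffWith_eq_zero_iff] at hS ⊢
  intro δ hδ ε hε
  have hK0 : (K : ℝ≥0∞) ≠ 0 := by simpa using hK.ne'
  have hKd : (K : ℝ≥0∞) ^ d ≠ ⊤ := ENNReal.rpow_ne_top_of_nonneg hd ENNReal.coe_ne_top
  have hKd0 : (K : ℝ≥0∞) ^ d ≠ 0 := (ENNReal.rpow_pos (by simpa using hK) ENNReal.coe_ne_top).ne'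
  obtain ⟨t, ht, hdiam, hlt⟩ := hS (δ / K) (ENNReal.div_pos hδ.ne' ENNReal.coe_ne_top)
    (ε / (K : ℝ≥0∞) ^ d) (ENNReal.div_pos hε.ne' hKd)
  have key : ∀ i, ediamWith ρ' (f '' (t i ∩ S)) ≤ K * ediamWith ρ (t i) := by
    intro i
    simp only [ediamWith, iSup_le_iff]
    rintro _ ⟨x, ⟨hx, hxS⟩, rfl⟩ _ ⟨y, ⟨hy, hyS⟩, rfl⟩
    refine (hf x hxS y hyS).trans (mul_le_mul_right ?_ _)
    exact le_iSup₂_of_le x hx (le_iSup₂_of_le y hy le_rfl)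
  refine ⟨fun i => f '' (t i ∩ S), ?_, fun i => ?_, ?_⟩
  · rintro _ ⟨x, hx, rfl⟩
    obtain ⟨i, hi⟩ := mem_iUnion.1 (ht hx)
    exact mem_iUnion.2 ⟨i, x, ⟨hi, hx⟩, rfl⟩
  · refine (key i).trans ((mul_le_mul_right (hdiam i) _).trans ?_)
    exact ENNReal.mul_div_le
  · refine lt_of_le_of_lt ?_ (ENNReal.mul_lt_of_lt_div' hlt)
    rw [← ENNReal.tsum_mul_left]
    refine ENNReal.tsum_le_tsum fun i => iSup_le fun hne => ?_
    have hne' : (t i).Nonempty := (image_nonempty.1 hne).mono inter_subset_left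
    simp only [hne', iSup_pos]
    rw [← ENNReal.mul_rpow_of_nonneg _ _ hd]
    exact ENNReal.rpow_le_rpow (key i) hd

theorem edist_le_immersionDist {M : Type*} [TopologicalSpace M] {n : ℕ} (F : M → Euc n) (c z : M) :
    edist (F c) (F z) ≤ immersionDist F c z := by
  refine le_iInf fun γ => le_iInf fun _ => le_iInf fun h0 => le_iInf fun h1 => ?_
  rw [← h0, ← h1]
  exact eVariationOn.edist_le (F ∘ γ) (s := Icc 0 1) (by simp) (by simp)

/-- The intrinsic distance is controlled by the distance in a convex Lipschitz parametrisation. -/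
theorem immersionDist_le_of_lipschitzOnWith {M E : Type*} [TopologicalSpace M]
    [NormedAddCommGroup E] [NormedSpace ℝ E] {n : ℕ} {F : M → Euc n} {g : E → M} {Q : Set E}
    (hQ : Convex ℝ Q) (hg : ContinuousOn g Q) {K : ℝ≥0} (hK : LipschitzOnWith K (F ∘ g) Q)
    {a b : E} (ha : a ∈ Q) (hb : b ∈ Q) :
    immersionDist F (g a) (g b) ≤ K * edist a b := by
  have hmaps : MapsTo (AffineMap.lineMap a b : ℝ → E) (Icc 0 1) Q := fun t ht =>
    hQ.lineMap_mem ha hb ht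
  have hcont : ContinuousOn (g ∘ (AffineMap.lineMap a b : ℝ → E)) (Icc 0 1) :=
    hg.comp AffineMap.lineMap_continuous.continuousOn hmaps
  have hle : immersionDist F (g a) (g b) ≤
      eVariationOn (F ∘ g ∘ (AffineMap.lineMap a b : ℝ → E)) (Icc 0 1) :=
    iInf_le_of_le _ (iInf_le_of_le hcont
      (iInf_le_of_le (by simp) (iInf_le_of_le (by simp) le_rfl)))
  refine hle.trans ?_
  refine (hK.comp_eVariationOn_le hmaps).trans (mul_le_mul_right ?_ _)
  have h1 : LipschitzWith (nndist a b) (AffineMap.lineMap a b : ℝ → E) :=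
    lipschitzWith_lineMap a b
  have h2 := (h1.lipschitzOnWith (s := Icc 0 1)).comp_eVariationOn_le (mapsTo_id (Icc (0 : ℝ) 1))
  have h3 : eVariationOn (id : ℝ → ℝ) (Icc 0 1) ≤ 1 := by
    have := (monotoneOn_id (s := Icc (0 : ℝ) 1)).eVariationOn_eq (a := 0) (b := 1)
      (by simp) (by simp)
    simp_all
  rw [edist_nndist]
  simpa using h2.trans (mul_le_mul_right h3 _)

/-- If the frontier of `D` is `ℋ^{dim - 1}`-negligible inside a convex open set `W`, then `W`
cannot meet both the interior and the exterior of `D`. -/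
theorem Convex.inter_interior_eq_empty_or {E : Type*} [NormedAddCommGroup E]
    [InnerProductSpace ℝ E] [FiniteDimensional ℝ E] [MeasurableSpace E] [BorelSpace E]
    {W D : Set E} (hW : Convex ℝ W) (hWo : IsOpen W) {d : ℝ}
    (hd : d = (Module.finrank ℝ E : ℝ) - 1)
    (hD : MeasureTheory.Measure.hausdorffMeasure d (frontier D ∩ W) = 0) :
    W ∩ interior D = ∅ ∨ W ∩ interior Dᶜ = ∅ := by
  by_contra! h
  obtain ⟨⟨a, haW, haD⟩, b, hbW, hbD⟩ := h
  have hab : b - a ≠ 0 := by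
    intro hba
    rw [sub_eq_zero.1 hba] at hbD
    exact interior_subset hbD (interior_subset haD)
  set V : Submodule ℝ E := (ℝ ∙ (b - a))ᗮ
  have hrank : (Module.finrank ℝ V : ℝ) = d := by
    have h1 := (ℝ ∙ (b - a)).finrank_add_finrank_orthogonal
    rw [finrank_span_singleton hab] at h1
    rw [hd, ← h1]
    push_cast
    ring
  have hd0 : 0 ≤ d := hrank ▸ Nat.cast_nonneg _
  let P : E →L[ℝ] V := V.orthogonalProjectionOnto
  have hnull : MeasureTheory.Measure.hausdorffMeasure (Module.finrank ℝ V : ℝ)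
      (P '' (frontier D ∩ W)) = 0 := by
    rw [hrank]
    have := (P.lipschitz.lipschitzOnWith (s := frontier D ∩ W)).hausdorffMeasure_image_le hd0
    rw [hD, mul_zero] at this
    exact le_antisymm this bot_le
  have hopen : IsOpen {v : V | (a + v ∈ W ∩ interior D ∧ b + v ∈ W ∩ interior Dᶜ)} :=
    ((hWo.inter isOpen_interior).preimage (by fun_prop : Continuous fun v : V => a + (v : E))).inter
      ((hWo.inter isOpen_interior).preimage (by fun_prop : Continuous fun v : V => b + (v : E)))
  have hopen' := hopen.preimage (by fun_prop : Continuous fun v : V => v - P a)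
  have hpos := hopen'.measure_pos (MeasureTheory.Measure.hausdorffMeasure (Module.finrank ℝ V : ℝ))
    ⟨P a, by simpa [-interior_compl] using ⟨⟨haW, haD⟩, hbW, hbD⟩⟩
  obtain ⟨u, ⟨⟨hau, haD'⟩, hbu, hbD'⟩, hu⟩ := MeasureTheory.nonempty_of_measure_ne_zero
    (((MeasureTheory.measure_sdiff_null hnull).trans_ne hpos.ne'))
  set v : V := u - P a
  have hPba : P (b - a) = 0 := by
    refine Submodule.orthogonalProjectionOnto_apply_of_mem_orthogonal ?_
    exact Submodule.le_orthogonal_orthogonal _ (Submodule.mem_span_singleton_self _)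
  have hseg : segment ℝ (a + v) (b + v : E) ⊆ interior D ∪ interior Dᶜ := by
    intro y hy
    have hyW : y ∈ W := hW.segment_subset hau hbu hy
    have hPy : P y = u := by
      rw [segment_eq_image'] at hy
      obtain ⟨t, -, rfl⟩ := hy
      have hPv : P (v : E) = v := V.orthogonalProjectionOnto_mem_subspace_eq_self v
      rw [show (b + v - (a + v) : E) = b - a by abel, map_add, map_add, map_smul, hPba, hPv]
      simp [v]
    have hyf : y ∉ frontier D := fun hf => hu ⟨y, ⟨hf, hyW⟩, hPy⟩
    rw [interior_compl]
    by_cases hc : y ∈ closure D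
    · exact Or.inl (by_contra fun hi => hyf ⟨hc, hi⟩)
    · exact Or.inr hc
  obtain ⟨y, -, hy1, hy2⟩ := (convex_segment (𝕜 := ℝ) (a + v : E) (b + v)).isPreconnected _ _
    isOpen_interior isOpen_interior hseg ⟨_, left_mem_segment _ _ _, haD'⟩
    ⟨_, right_mem_segment _ _ _, hbD'⟩
  exact interior_subset hy2 (interior_subset hy1)

/-- A `C¹` map on a convex set with injective derivative at `x` is locally bi-Lipschitz. -/
theorem exists_bilipschitz_of_contDiffWithinAt {E G : Type*} [NormedAddCommGroup E] [NormedSpace ℝ E]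
    [FiniteDimensional ℝ E] [NormedAddCommGroup G] [NormedSpace ℝ G] {f : E → G} {s : Set E} {x : E}
    (hf : ContDiffWithinAt ℝ 1 f s x) (hs : Convex ℝ s) (hx : x ∈ s)
    (hu : UniqueDiffWithinAt ℝ s x) (hinj : Function.Injective (fderivWithin ℝ f s x)) :
    ∃ K₁ K₂ : ℝ≥0, ∃ t ∈ 𝓝[s] x, LipschitzOnWith K₂ f t ∧
      ∀ a ∈ t, ∀ b ∈ t, edist a b ≤ K₁ * edist (f a) (f b) := by
  obtain ⟨K₂, t₂, ht₂, hK₂⟩ := hf.exists_lipschitzOnWith hs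
  set L : E →L[ℝ] G := fderivWithin ℝ f s x
  obtain ⟨K, hKpos, hK⟩ := (L : E →ₗ[ℝ] G).exists_antilipschitzWith (LinearMap.ker_eq_bot.2 hinj)
  obtain ⟨u, hu', -, -, f', hf', hf'c⟩ :=
    (contDiffWithinAt_succ_iff_hasFDerivWithinAt' (n := 0) (by simp)).1 (by simpa using hf)
  rw [insert_eq_of_mem hx] at hu'
  have hfx : f' x = L :=
    ((hf' x (mem_of_mem_nhdsWithin hx hu')).fderivWithin hu).symm
  have hder : ∀ᶠ y in 𝓝[s] x, HasFDerivWithinAt (fun z => f z - L z) (f' y - L) s y := by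
    filter_upwards [hu'] with y hy using (hf' y hy).sub L.hasFDerivWithinAt
  obtain ⟨t₁, ht₁, hg⟩ := hs.exists_nhdsWithin_lipschitzOnWith_of_hasFDerivWithinAt_of_nnnorm_lt
    hder (hf'c.continuousWithinAt.sub continuousWithinAt_const) (2 * K)⁻¹ (by simpa [hfx])
  refine ⟨2 * K, K₂, t₁ ∩ t₂, Filter.inter_mem ht₁ ht₂, hK₂.mono inter_subset_right, ?_⟩
  intro a ha b hb
  have h1 : dist a b ≤ K * dist (L a) (L b) := hK.le_mul_dist a b
  have h2 := hg.dist_le_mul a ha.1 b hb.1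
  have h3 : dist (L a) (L b) ≤ dist (f a) (f b) + dist (f a - L a) (f b - L b) := by
    simp only [dist_eq_norm]
    rw [show L a - L b = (f a - f b) - (f a - L a - (f b - L b)) by abel]
    exact norm_sub_le _ _
  have hKp : (0 : ℝ) < K := hKpos
  have h4 : dist a b ≤ 2 * K * dist (f a) (f b) := by
    have h5 : (K : ℝ) * dist (f a - L a) (f b - L b) ≤ dist a b / 2 := by
      refine (mul_le_mul_of_nonneg_left h2 hKp.le).trans_eq ?_
      push_cast
      field_simp
    nlinarith [mul_le_mul_of_nonneg_left h3 hKp.le]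
  have h6 : nndist a b ≤ 2 * K * nndist (f a) (f b) := by
    rw [← NNReal.coe_le_coe]
    simpa using h4
  simp only [edist_nndist]
  exact_mod_cast h6

section Chart

variable {E H M : Type*} [NormedAddCommGroup E] [InnerProductSpace ℝ E]
  [TopologicalSpace H] {I : ModelWithCorners ℝ E H} [TopologicalSpace M] [ChartedSpace H M]
  {n : ℕ} {F : M → Euc n}

theorem exists_bilipschitz_extChartAt [FiniteDimensional ℝ E] (hF : ContMDiff I 𝓘(ℝ, Euc n) 1 F) {x : M}
    (hx : Function.Injective (mfderiv I 𝓘(ℝ, Euc n) F x)) :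
    ∃ r > 0, ∃ K₁ K₂ : ℝ≥0, ball (extChartAt I x x) r ∩ range I ⊆ (extChartAt I x).target ∧
      LipschitzOnWith K₂ (F ∘ (extChartAt I x).symm) (ball (extChartAt I x x) r ∩ range I) ∧
      ∀ a ∈ ball (extChartAt I x x) r ∩ range I, ∀ b ∈ ball (extChartAt I x x) r ∩ range I,
        edist a b ≤
          K₁ * edist ((F ∘ (extChartAt I x).symm) a) ((F ∘ (extChartAt I x).symm) b) := by
  have hFx : ContDiffWithinAt ℝ 1 (F ∘ (extChartAt I x).symm) (range I) (extChartAt I x x) := by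
    simpa using! (contMDiffAt_iff.1 (hF x)).2
  have hd : mfderiv I 𝓘(ℝ, Euc n) F x =
      fderivWithin ℝ (F ∘ (extChartAt I x).symm) (range I) (extChartAt I x x) :=
    ((hF x).mdifferentiableAt one_ne_zero).mfderiv
  have hmem : extChartAt I x x ∈ range I := mem_range_self _
  obtain ⟨K₁, K₂, t, ht, hK₂, hK₁⟩ := exists_bilipschitz_of_contDiffWithinAt hFx I.convex_range
    hmem (I.uniqueDiffOn _ hmem) (hd ▸ hx)
  obtain ⟨r, hr, hrt⟩ :=
    mem_nhdsWithin_iff.1 (Filter.inter_mem ht (extChartAt_target_mem_nhdsWithin (I := I) x))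
  exact ⟨r, hr, K₁, K₂, hrt.trans inter_subset_right, hK₂.mono (hrt.trans inter_subset_left),
    fun a ha b hb => hK₁ a (hrt ha).1 b (hrt hb).1⟩

theorem extChartAt_symm_mem_frontier_sdiff_boundary [IsManifold I 1 M] {x : M} {W : Set E}
    (hWo : IsOpen W) (hWt : W ⊆ (extChartAt I x).target) {C : Set M} {y : E}
    (hy : y ∈ frontier ((extChartAt I x).symm ⁻¹' C)) (hyW : y ∈ W) :
    (extChartAt I x).symm y ∈ frontier C \ I.boundary M := by
  have hc : ContinuousAt (extChartAt I x).symm y :=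
    ((continuousOn_extChartAt_symm x).mono hWt).continuousAt (hWo.mem_nhds hyW)
  refine ⟨⟨?_, fun hi => hy.2 ?_⟩, ?_⟩
  · exact hc.continuousWithinAt.mem_closure hy.1 (mapsTo_preimage _ _)
  · exact mem_interior_iff_mem_nhds.2
      (hc.preimage_mem_nhds (mem_interior_iff_mem_nhds.1 hi))
  · rw [← I.compl_interior, notMem_compl_iff]
    refine (I.isInteriorPoint_iff_of_mem_atlas (n := 1) one_ne_zero (chart_mem_atlas H x) ?_).2 ?_
    · simpa using (extChartAt I x).map_target (hWt hyW)
    · have := (extChartAt I x).right_inv (hWt hyW)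
      rw [extChartAt] at this hWt ⊢
      rw [this]
      exact interior_maximal hWt hWo hyW

variable [MeasurableSpace E] [BorelSpace E]

theorem hausdorffMeasure_extChartAt_image_null {x : M} {Q : Set E} {K : ℝ≥0}
    (hK : ∀ a ∈ Q, ∀ b ∈ Q, edist a b ≤
      K * edist ((F ∘ (extChartAt I x).symm) a) ((F ∘ (extChartAt I x).symm) b))
    {S : Set M} (hS : S ⊆ (extChartAt I x).source) (hSQ : MapsTo (extChartAt I x) S Q)
    {d : ℝ} (hd : 0 ≤ d) (h : hausdorffWith (immersionDist F) d S = 0) :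
    MeasureTheory.Measure.hausdorffMeasure d (extChartAt I x '' S) = 0 := by
  rw [← hausdorffWith_edist]
  refine hausdorffWith_image_null (K := K) hd (fun a ha b hb => ?_) h
  refine (hK _ (hSQ ha) _ (hSQ hb)).trans ?_
  simp only [Function.comp_apply, (extChartAt I x).left_inv (hS ha),
    (extChartAt I x).left_inv (hS hb)]
  exact mul_le_mul_right (edist_le_immersionDist F a b) _

theorem hausdorffWith_extChartAt_symm_image_null {x : M} {Q : Set E} (hQ : Convex ℝ Q)
    (hQt : Q ⊆ (extChartAt I x).target) {K : ℝ≥0}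
    (hK : LipschitzOnWith K (F ∘ (extChartAt I x).symm) Q) {T : Set E} (hT : T ⊆ Q)
    {d : ℝ} (hd : 0 ≤ d) (h : MeasureTheory.Measure.hausdorffMeasure d T = 0) :
    hausdorffWith (immersionDist F) d ((extChartAt I x).symm '' T) = 0 := by
  rw [← hausdorffWith_edist] at h
  exact hausdorffWith_image_null hd (fun a ha b hb => immersionDist_le_of_lipschitzOnWith hQ
    ((continuousOn_extChartAt_symm x).mono hQt) hK (hT ha) (hT hb)) h

theorem hausdorffWith_ne_zero_of_mem_nhds [FiniteDimensional ℝ E]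
    (hF : ContMDiff I 𝓘(ℝ, Euc n) 1 F)
    (hImm : ∀ x : M, Function.Injective (mfderiv I 𝓘(ℝ, Euc n) F x)) {x : M} {U : Set M}
    (hU : U ∈ 𝓝 x) : hausdorffWith (immersionDist F) (Module.finrank ℝ E) U ≠ 0 := by
  intro h
  obtain ⟨r, hr, K₁, -, -, -, hK₁⟩ := exists_bilipschitz_extChartAt hF (hImm x)
  have hV : U ∩ ((extChartAt I x).source ∩ extChartAt I x ⁻¹' ball (extChartAt I x x) r) ∈ 𝓝 x :=
    Filter.inter_mem hU (Filter.inter_mem (extChartAt_source_mem_nhds x)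
      ((continuousAt_extChartAt x).preimage_mem_nhds (ball_mem_nhds _ hr)))
  have hnull := hausdorffMeasure_extChartAt_image_null hK₁
    (S := U ∩ ((extChartAt I x).source ∩ extChartAt I x ⁻¹' ball (extChartAt I x x) r))
    (fun y hy => hy.2.1) (fun y hy => ⟨hy.2.2, mem_range_self _⟩) (Nat.cast_nonneg _)
    (hausdorffWith_mono_null inter_subset_left h)
  have himg := Filter.image_mem_map (m := extChartAt I x) hV
  rw [map_extChartAt_nhds, mem_nhdsWithin] at himg
  obtain ⟨O, hO, hxO, hsub⟩ := himg
  have hne : (O ∩ interior (range I)).Nonempty :=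
    mem_closure_iff.1 (I.range_subset_closure_interior (mem_range_self _)) O hO hxO
  refine ((hO.inter isOpen_interior).measure_pos
    (MeasureTheory.Measure.hausdorffMeasure (Module.finrank ℝ E : ℝ)) hne).ne' ?_
  exact MeasureTheory.measure_mono_null
    ((inter_subset_inter_right _ interior_subset).trans hsub) hnull

/-- A set whose relative boundary is `ℋ^{dim - 1}`-negligible is locally of measure zero or of full
measure. -/
theorem exists_nhds_hausdorffWith_inter_eq_zero_or [FiniteDimensional ℝ E] [IsManifold I 1 M]
    (hF : ContMDiff I 𝓘(ℝ, Euc n) 1 F)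
    (hImm : ∀ x : M, Function.Injective (mfderiv I 𝓘(ℝ, Euc n) F x)) {d : ℝ}
    (hd : d = Module.finrank ℝ E) (hd1 : 1 ≤ d) {C : Set M}
    (hC : hausdorffWith (immersionDist F) (d - 1) (frontier C \ I.boundary M) = 0) (x : M) :
    ∃ U ∈ 𝓝 x, hausdorffWith (immersionDist F) d (U ∩ C) = 0 ∨
      hausdorffWith (immersionDist F) d (U ∩ Cᶜ) = 0 := by
  obtain ⟨r, hr, K₁, K₂, hQt, hK₂, hK₁⟩ := exists_bilipschitz_extChartAt hF (hImm x)
  set φ := extChartAt I x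
  set Q := ball (φ x) r ∩ range I
  set W := ball (φ x) r ∩ interior (range I)
  have hQ : Convex ℝ Q := (convex_ball _ _).inter I.convex_range
  have hW : Convex ℝ W := (convex_ball _ _).inter I.convex_range.interior
  have hWo : IsOpen W := isOpen_ball.inter isOpen_interior
  have hWQ : W ⊆ Q := inter_subset_inter_right _ interior_subset
  have hfr : MeasureTheory.Measure.hausdorffMeasure (d - 1) (frontier (φ.symm ⁻¹' C) ∩ W) = 0 := by
    have hS : φ.symm '' (frontier (φ.symm ⁻¹' C) ∩ W) ⊆ frontier C \ I.boundary M := by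
      rintro _ ⟨y, ⟨hy, hyW⟩, rfl⟩
      exact extChartAt_symm_mem_frontier_sdiff_boundary hWo (hWQ.trans hQt) hy hyW
    have hinv : ∀ y ∈ W, φ (φ.symm y) = y := fun y hy => φ.right_inv (hQt (hWQ hy))
    refine MeasureTheory.measure_mono_null ?_ (hausdorffMeasure_extChartAt_image_null hK₁
      (S := φ.symm '' (frontier (φ.symm ⁻¹' C) ∩ W)) ?_ ?_ (by linarith)
      (hausdorffWith_mono_null hS hC))
    · exact fun y hy => ⟨_, ⟨y, hy, rfl⟩, hinv y hy.2⟩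
    · rintro _ ⟨y, hy, rfl⟩
      exact φ.map_target (hQt (hWQ hy.2))
    · rintro _ ⟨y, hy, rfl⟩
      exact (hinv y hy.2).symm ▸ hWQ hy.2
  have hcase : ∀ A : Set M, W ∩ interior (φ.symm ⁻¹' A) = ∅ →
      frontier (φ.symm ⁻¹' A) = frontier (φ.symm ⁻¹' C) →
      hausdorffWith (immersionDist F) d (φ.source ∩ φ ⁻¹' ball (φ x) r ∩ A) = 0 := by
    intro A hA hAC
    have hT : MeasureTheory.Measure.hausdorffMeasure d
        (Q ∩ (frontier (φ.symm ⁻¹' C) ∩ W ∪ frontier (range I))) = 0 := by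
      refine MeasureTheory.measure_mono_null inter_subset_right
        (MeasureTheory.measure_union_null ?_ ?_)
      · exact le_antisymm ((MeasureTheory.Measure.hausdorffMeasure_mono (by linarith) _).trans
          hfr.le) bot_le
      · rw [hd]
        exact I.convex_range.addHaar_frontier _
    refine hausdorffWith_mono_null ?_ (hausdorffWith_extChartAt_symm_image_null hQ hQt hK₂
      inter_subset_left (by linarith) hT)
    rintro y ⟨⟨hys, hyb⟩, hyA⟩
    have hyR : φ y ∈ range I := mem_range_self _
    have hyD : φ y ∈ φ.symm ⁻¹' A := by simpa [φ.left_inv hys] using hyA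
    refine ⟨φ y, ⟨⟨hyb, hyR⟩, ?_⟩, φ.left_inv hys⟩
    by_cases hi : φ y ∈ interior (range I)
    · rw [← hAC]
      exact Or.inl ⟨⟨subset_closure hyD, fun h => (hA ▸ ⟨⟨hyb, hi⟩, h⟩ : φ y ∈ (∅ : Set E))⟩,
        hyb, hi⟩
    · exact Or.inr ⟨subset_closure hyR, hi⟩
  refine ⟨φ.source ∩ φ ⁻¹' ball (φ x) r, Filter.inter_mem (extChartAt_source_mem_nhds x)
      ((continuousAt_extChartAt x).preimage_mem_nhds (ball_mem_nhds _ hr)), ?_⟩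
  refine (hW.inter_interior_eq_empty_or hWo (by rw [hd]) hfr).imp
    (fun h => hcase C h rfl) (fun h => hcase Cᶜ ?_ ?_)
  · rwa [preimage_compl]
  · rw [preimage_compl, frontier_compl]

end Chart

theorem hausdorffWith_null_of_locally_null {X : Type*} [TopologicalSpace X]
    [SecondCountableTopology X] {ρ : X → X → ℝ≥0∞} {d : ℝ} {S : Set X}
    (h : ∀ x, ∃ U ∈ 𝓝 x, hausdorffWith ρ d (U ∩ S) = 0) : hausdorffWith ρ d S = 0 := by
  choose U hU hnull using h
  rcases isEmpty_or_nonempty X with hX | hX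
  · exact hausdorffWith_mono_null (T := ⋃ _ : ℕ, ∅) (by simp [S.eq_empty_of_isEmpty])
      (hausdorffWith_iUnion_null fun _ => hausdorffWith_eq_zero_iff.2 fun δ _ ε hε =>
        ⟨fun _ => ∅, by simp, by simp [ediamWith], by simpa⟩)
  obtain ⟨s, hs, hsU⟩ := TopologicalSpace.countable_cover_nhds hU
  have hne : s.Nonempty := by
    by_contra! h0
    simp [h0] at hsU
    exact (empty_ne_univ hsU)
  obtain ⟨f, rfl⟩ := hs.exists_eq_range hne
  refine hausdorffWith_mono_null ?_ (hausdorffWith_iUnion_null fun k => hnull (f k))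
  intro y hy
  have : y ∈ ⋃ x ∈ range f, U x := hsU ▸ mem_univ y
  simpa [hy] using this

/-- **constancy theorem.** Let `M` be a connected `m`-dimensional
manifold-with-boundary of class `C¹`, `F : M → ℝⁿ` a `C¹` immersion (`m ≤ n`), `σ` the
intrinsic distance induced by `F`, and `C ⊆ M` with
`ℋ^{m-1}_σ((Bdry C) ∖ ∂M) = 0` (`Bdry C` being the topological frontier of `C` in `M`).
Then `ℋ^m_σ(C) = 0` or `ℋ^m_σ(M ∖ C) = 0`. -/
theorem constancy_theorem (m n : ℕ) [NeZero m] (hm : 0 < m) (hn : 0 < n) (hmn : m ≤ n)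
    (M : Type) [TopologicalSpace M] [T2Space M] [SecondCountableTopology M]
    [ChartedSpace (EuclideanHalfSpace m) M]
    [HasGroupoid M (contDiffGroupoid 1 (𝓡∂ m))] [ConnectedSpace M]
    (F : M → Euc n)
    (hF : ContMDiff (𝓡∂ m) 𝓘(ℝ, Euc n) 1 F)
    (hImm : ∀ x : M, Function.Injective (mfderiv (𝓡∂ m) 𝓘(ℝ, Euc n) F x))
    (C : Set M)
    (hC : hausdorffWith (immersionDist F) ((m : ℝ) - 1)
      (frontier C \ (𝓡∂ m).boundary M) = 0) :
    hausdorffWith (immersionDist F) (m : ℝ) C = 0 ∨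
      hausdorffWith (immersionDist F) (m : ℝ) (Set.univ \ C) = 0 := by
  have : IsManifold (𝓡∂ m) 1 M := ⟨⟩
  have hrank : (m : ℝ) = Module.finrank ℝ (EuclideanSpace ℝ (Fin m)) := by simp
  have hloc := exists_nhds_hausdorffWith_inter_eq_zero_or hF hImm hrank
    (by exact_mod_cast hm) hC
  have hopen : ∀ A : Set M,
      IsOpen {x : M | ∃ U ∈ 𝓝 x, hausdorffWith (immersionDist F) (m : ℝ) (U ∩ A) = 0} := by
    refine fun A => isOpen_iff_mem_nhds.2 fun x ⟨U, hU, h⟩ => ?_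
    filter_upwards [eventually_mem_nhds_iff.2 hU] with y hy using ⟨U, hy, h⟩
  have hcompl : {x : M | ∃ U ∈ 𝓝 x, hausdorffWith (immersionDist F) (m : ℝ) (U ∩ C) = 0}ᶜ =
      {x : M | ∃ U ∈ 𝓝 x, hausdorffWith (immersionDist F) (m : ℝ) (U ∩ Cᶜ) = 0} := by
    ext x
    constructor
    · intro hx
      obtain ⟨U, hU, h | h⟩ := hloc x
      · exact absurd ⟨U, hU, h⟩ hx
      · exact ⟨U, hU, h⟩
    · rintro ⟨V, hV, h'⟩ ⟨U, hU, h⟩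
      refine hausdorffWith_ne_zero_of_mem_nhds hF hImm (Filter.inter_mem hU hV) ?_
      rw [← hrank]
      refine hausdorffWith_mono_null ?_
        (hausdorffWith_iUnion_null (S := fun k : ℕ => if k = 0 then U ∩ C else V ∩ Cᶜ) ?_)
      · intro y hy
        by_cases hyC : y ∈ C
        · exact mem_iUnion.2 ⟨0, by simpa using ⟨hy.1, hyC⟩⟩
        · exact mem_iUnion.2 ⟨1, by simpa using ⟨hy.2, hyC⟩⟩
      · intro k
        split_ifs
        exacts [h, h']
  rw [← compl_eq_univ_sdiff]
  rcases isClopen_iff.1 ⟨⟨hcompl ▸ hopen Cᶜ⟩, hopen C⟩ with h | h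
  · rw [h, compl_empty] at hcompl
    exact Or.inr (hausdorffWith_null_of_locally_null fun x => hcompl.subset (mem_univ x))
  · exact Or.inl (hausdorffWith_null_of_locally_null fun x => h.superset (mem_univ x))

end
end

section
/- Suppose m and n are positive integers with m ≤ n, M is a connected m-dimensional manifold-with-boundary of class C¹, F : M → ℝⁿ is an immersion of class C¹, and σ : M × M → [0,∞] is defined by σ(c,z) = inf{ Var(F∘C) : C : [0,1] → M continuous, C(0) = c, C(1) = z }, where Var denotes total variation. Then σ is finite everywhere, σ is a metric on M, and the topology on M induced by σ coincides with the given topology of M. -/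
open Set Metric
open scoped ENNReal Manifold Topology

noncomputable section

section PathDistance

variable {M : Type*} [TopologicalSpace M] {n : ℕ} {F : M → Euc n}

theorem immersionDist_le (F : M → Euc n) {C : ℝ → M} (hC : ContinuousOn C (Icc 0 1)) :
    immersionDist F (C 0) (C 1) ≤ eVariationOn (F ∘ C) (Icc 0 1) :=
  iInf₂_le_of_le C hC <| iInf₂_le_of_le rfl rfl le_rfl

theorem le_immersionDist {c z : M} {a : ℝ≥0∞}
    (h : ∀ C : ℝ → M, ContinuousOn C (Icc 0 1) → C 0 = c → C 1 = z →
      a ≤ eVariationOn (F ∘ C) (Icc 0 1)) : a ≤ immersionDist F c z :=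
  le_iInf₂ fun C hC => le_iInf₂ fun h0 h1 => h C hC h0 h1

theorem immersionDist_self (F : M → Euc n) (c : M) : immersionDist F c c = 0 := by
  refine le_antisymm ?_ bot_le
  refine (immersionDist_le F (C := fun _ => c) continuousOn_const).trans_eq ?_
  exact eVariationOn.constant_on (by rintro _ ⟨x, -, rfl⟩ _ ⟨y, -, rfl⟩; rfl)

theorem immersionDist_comm_le (F : M → Euc n) (c z : M) :
    immersionDist F c z ≤ immersionDist F z c := by
  refine le_immersionDist fun C hC h0 h1 => ?_
  have hmaps : MapsTo (fun t : ℝ => 1 - t) (Icc 0 1) (Icc 0 1) := fun t ht =>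
    ⟨by linarith [ht.2], by linarith [ht.1]⟩
  have key := immersionDist_le F (C := C ∘ fun t => 1 - t) (hC.comp (by fun_prop) hmaps)
  simp only [Function.comp_apply, sub_zero, sub_self, h0, h1] at key
  exact key.trans <| eVariationOn.comp_le_of_antitoneOn (F ∘ C) _
    (fun _ _ _ _ h => sub_le_sub_left h 1) hmaps

theorem immersionDist_comm (F : M → Euc n) (c z : M) :
    immersionDist F c z = immersionDist F z c :=
  le_antisymm (immersionDist_comm_le F c z) (immersionDist_comm_le F z c)

theorem immersionDist_triangle (F : M → Euc n) (c y z : M) :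
    immersionDist F c z ≤ immersionDist F c y + immersionDist F y z := by
  conv_rhs => simp only [immersionDist]
  simp only [ENNReal.iInf_add, ENNReal.add_iInf]
  refine le_iInf₂ fun C₂ hC₂ => le_iInf₂ fun h20 h21 => ?_
  refine le_iInf₂ fun C₁ hC₁ => le_iInf₂ fun h10 h11 => ?_
  set C : ℝ → M := fun t => if t ≤ 1 / 2 then C₁ (2 * t) else C₂ (2 * t - 1) with hCdef
  have hmaps₁ : MapsTo (fun t : ℝ => 2 * t) (Icc 0 (1 / 2)) (Icc 0 1) := fun t ht =>
    ⟨by linarith [ht.1], by linarith [ht.2]⟩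
  have hmaps₂ : MapsTo (fun t : ℝ => 2 * t - 1) (Icc (1 / 2) 1) (Icc 0 1) := fun t ht =>
    ⟨by linarith [ht.1], by linarith [ht.2]⟩
  have heq₁ : EqOn C (C₁ ∘ fun t => 2 * t) (Icc 0 (1 / 2)) := fun t ht => by
    simp only [hCdef, if_pos ht.2, Function.comp_apply]
  have heq₂ : EqOn C (C₂ ∘ fun t => 2 * t - 1) (Icc (1 / 2) 1) := fun t ht => by
    rcases ht.1.eq_or_lt with rfl | h
    · simp [hCdef, h11, h20]
    · simp only [hCdef, if_neg h.not_ge, Function.comp_apply]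
  have hC : ContinuousOn C (Icc 0 1) := by
    rw [← Icc_union_Icc_eq_Icc (show (0 : ℝ) ≤ 1 / 2 by norm_num) (by norm_num)]
    exact ((hC₁.comp (by fun_prop) hmaps₁).congr heq₁).union_of_isClosed
      ((hC₂.comp (by fun_prop) hmaps₂).congr heq₂) isClosed_Icc isClosed_Icc
  have key := immersionDist_le F hC
  have hC0 : C 0 = c := by simp [hCdef, h10]
  have hC1 : C 1 = z := by norm_num [hCdef, h21]
  rw [hC0, hC1] at key
  refine key.trans ?_
  have hsplit := eVariationOn.Icc_add_Icc (F ∘ C) (s := univ)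
    (show (0 : ℝ) ≤ 1 / 2 by norm_num) (show (1 / 2 : ℝ) ≤ 1 by norm_num) (mem_univ _)
  simp only [univ_inter] at hsplit
  rw [← hsplit, eVariationOn.eq_of_eqOn (heq₁.comp_left (g := F)),
    eVariationOn.eq_of_eqOn (heq₂.comp_left (g := F))]
  gcongr
  · exact eVariationOn.comp_le_of_monotoneOn (F ∘ C₁) (fun t => 2 * t)
      (fun a _ b _ h => show 2 * a ≤ 2 * b by linarith) hmaps₁
  · exact eVariationOn.comp_le_of_monotoneOn (F ∘ C₂) (fun t => 2 * t - 1)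
      (fun a _ b _ h => show 2 * a - 1 ≤ 2 * b - 1 by linarith) hmaps₂

theorem immersionDist_ne_top_of_eventually [PreconnectedSpace M]
    (h : ∀ c : M, ∀ᶠ z in 𝓝 c, immersionDist F c z ≠ ⊤) (c z : M) :
    immersionDist F c z ≠ ⊤ := by
  have hopen : ∀ P : M → Prop, (∀ y w, immersionDist F y w ≠ ⊤ → P y → P w) →
      IsOpen {y | P y} := fun P hP => isOpen_iff_mem_nhds.2 fun y hy =>
    (h y).mono fun w hw => hP y w hw hy
  have htrans : ∀ {a b d : M}, immersionDist F a b ≠ ⊤ → immersionDist F b d ≠ ⊤ →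
      immersionDist F a d ≠ ⊤ := fun hab hbd =>
    ne_top_of_le_ne_top (ENNReal.add_ne_top.2 ⟨hab, hbd⟩) (immersionDist_triangle F _ _ _)
  have hclopen : IsClopen {y | immersionDist F c y ≠ ⊤} := by
    refine ⟨⟨hopen (fun y => ¬ immersionDist F c y ≠ ⊤) fun y w hyw hy hw => hy ?_⟩,
      hopen _ fun y w hyw hy => htrans hy hyw⟩
    exact htrans hw (by rwa [immersionDist_comm])
  have huniv := hclopen.eq_univ ⟨c, by simp [immersionDist_self]⟩
  exact huniv.ge (mem_univ z)

/-- A path from a point of the open set `V` to a point outside of `V` meets `K \ V` for every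
closed set `K ⊇ V`. -/
theorem exists_mem_diff_of_continuousOn {V K : Set M} (hV : IsOpen V) (hK : IsClosed K)
    (hVK : V ⊆ K) {C : ℝ → M} (hC : ContinuousOn C (Icc 0 1)) (h0 : C 0 ∈ V) (h1 : C 1 ∉ V) :
    ∃ t ∈ Icc (0 : ℝ) 1, C t ∈ K \ V := by
  by_contra! hcon
  have hpre : IsPreconnected (C '' Icc 0 1) := isPreconnected_Icc.image C hC
  have hmem : ∀ t ∈ Icc (0 : ℝ) 1, C t ∉ V → C t ∉ K := fun t ht htV htK =>
    hcon t ht ⟨htK, htV⟩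
  obtain ⟨y, -, hyV, hyK⟩ := hpre V Kᶜ hV hK.isOpen_compl
    (by
      rintro _ ⟨t, ht, rfl⟩
      by_cases h : C t ∈ V
      · exact Or.inl h
      · exact Or.inr (hmem t ht h))
    ⟨C 0, ⟨0, by simp, rfl⟩, h0⟩ ⟨C 1, ⟨1, by simp, rfl⟩, hmem 1 (by simp) h1⟩
  exact hyK (hVK hyV)

end PathDistance

section Charts

variable {E : Type*} [NormedAddCommGroup E] [NormedSpace ℝ E]
  {H : Type*} [TopologicalSpace H] {I : ModelWithCorners ℝ E H}
  {M : Type*} [TopologicalSpace M] [ChartedSpace H M] {n : ℕ} {F : M → Euc n}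

/-- Following a straight segment in a chart bounds the intrinsic distance. -/
theorem exists_eventually_immersionDist_le {x : M} (hF : ContMDiffAt I 𝓘(ℝ, Euc n) 1 F x) :
    ∃ K : NNReal, ∀ᶠ z in 𝓝 x,
      immersionDist F x z ≤ K * edist (extChartAt I x x) (extChartAt I x z) := by
  obtain ⟨-, hF⟩ := contMDiffAt_iff.1 hF
  obtain ⟨K, t, ht, hLip⟩ := hF.exists_lipschitzOnWith I.convex_range
  obtain ⟨r, hr, hsub⟩ := Metric.mem_nhdsWithin_iff.1
    (Filter.inter_mem ht (extChartAt_target_mem_nhdsWithin (I := I) x))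
  refine ⟨K, ?_⟩
  filter_upwards [extChartAt_source_mem_nhds (I := I) x,
    (continuousAt_extChartAt (I := I) x).preimage_mem_nhds (Metric.ball_mem_nhds _ hr)]
    with z hz hzr
  set p := extChartAt I x x
  set q := extChartAt I x z
  have hline : MapsTo (AffineMap.lineMap p q : ℝ → E) (Icc 0 1)
      (ball p r ∩ range I) := fun s hs =>
    ((convex_ball p r).inter I.convex_range).lineMap_mem
      ⟨mem_ball_self hr, extChartAt_target_subset_range x (mem_extChartAt_target x)⟩
      ⟨hzr, extChartAt_target_subset_range x ((extChartAt I x).map_source hz)⟩ hs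
  have hcont : ContinuousOn ((extChartAt I x).symm ∘ (AffineMap.lineMap p q : ℝ → E))
      (Icc 0 1) :=
    (continuousOn_extChartAt_symm x).comp AffineMap.lineMap_continuous.continuousOn
      fun s hs => (hsub (hline hs)).2
  have key := immersionDist_le F hcont
  simp only [Function.comp_apply, AffineMap.lineMap_apply_zero, AffineMap.lineMap_apply_one,
    p, q, extChartAt_to_inv, (extChartAt I x).left_inv hz] at key
  refine key.trans ?_
  have hLip' : LipschitzOnWith K (F ∘ (extChartAt I x).symm) t := hLip
  refine (hLip'.comp_eVariationOn_le fun s hs => (hsub (hline hs)).1).trans ?_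
  gcongr
  have hl := (lipschitzWith_lineMap (𝕜 := ℝ) p q).lipschitzOnWith (s := univ)
  refine (hl.comp_eVariationOn_le (g := id) (s := Icc 0 1) fun _ _ => mem_univ _).trans ?_
  have hid := (monotone_id.monotoneOn (univ : Set ℝ)).eVariationOn_eq
    (mem_univ 0) (mem_univ 1)
  simp only [univ_inter, id, sub_zero, ENNReal.ofReal_one] at hid
  calc _ ≤ (nndist p q : ℝ≥0∞) * 1 := by gcongr; exact hid.le
    _ = edist p q := by rw [mul_one, edist_nndist]

theorem eventually_immersionDist_lt {x : M} (hF : ContMDiffAt I 𝓘(ℝ, Euc n) 1 F x)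
    {ε : ℝ≥0∞} (hε : 0 < ε) : ∀ᶠ z in 𝓝 x, immersionDist F x z < ε := by
  obtain ⟨K, hK⟩ := exists_eventually_immersionDist_le hF
  have hlim : Filter.Tendsto
      (fun z => (K : ℝ≥0∞) * edist (extChartAt I x x) (extChartAt I x z)) (𝓝 x) (𝓝 0) := by
    have h := ENNReal.Tendsto.const_mul (a := (K : ℝ≥0∞))
      (Filter.Tendsto.edist (tendsto_const_nhds (x := extChartAt I x x))
        (continuousAt_extChartAt (I := I) x).tendsto) (Or.inr ENNReal.coe_ne_top)
    simpa only [edist_self, mul_zero] using h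
  filter_upwards [hK, hlim.eventually (gt_mem_nhds hε)] with z h1 h2
  exact h1.trans_lt h2

/-- Points outside a neighbourhood of `x` stay at positive intrinsic distance from `x`, as soon
as the differential of `F` at `x` is injective. -/
theorem exists_pos_le_immersionDist [FiniteDimensional ℝ E] [T2Space M] {x : M}
    (hF : MDifferentiableAt I 𝓘(ℝ, Euc n) F x)
    (hinj : Function.Injective (mfderiv I 𝓘(ℝ, Euc n) F x)) {s : Set M} (hs : s ∈ 𝓝 x) :
    ∃ ε : ℝ≥0∞, 0 < ε ∧ ∀ z ∉ s, ε ≤ immersionDist F x z := by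
  set φ := extChartAt I x
  obtain ⟨f', hf', hinj'⟩ : ∃ f' : E →L[ℝ] Euc n,
      HasFDerivWithinAt (F ∘ φ.symm) f' (range I) (φ x) ∧ Function.Injective f' :=
    ⟨mfderiv I 𝓘(ℝ, Euc n) F x, hF.hasMFDerivAt.2, hinj⟩
  obtain ⟨A, -, hA⟩ := f'.toLinearMap.injective_iff_antilipschitz.1 hinj'
  obtain ⟨B, hB, hbound⟩ :=
    (hf'.isTheta_sub (hA.isInducing f'.continuous)).2.exists_pos
  have hsymm : φ.symm ⁻¹' s ∈ 𝓝[range I] (φ x) := by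
    have := map_extChartAt_symm_nhdsWithin_range (I := I) x
    rw [← Filter.mem_map, this]
    exact hs
  obtain ⟨R, hR, hsub⟩ := Metric.mem_nhdsWithin_iff.1 (Filter.inter_mem hbound.bound
    (Filter.inter_mem hsymm (extChartAt_target_mem_nhdsWithin (I := I) x)))
  obtain ⟨r, hr, hrR⟩ := exists_between hR
  have hsub' := (inter_subset_inter_left (range I) (closedBall_subset_ball hrR)).trans hsub
  set V : Set M := φ.source ∩ φ ⁻¹' ball (φ x) r
  set K : Set M := φ.symm '' (closedBall (φ x) r ∩ range I)
  have hV : IsOpen V := (continuousOn_extChartAt x).isOpen_inter_preimage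
    (isOpen_extChartAt_source x) isOpen_ball
  have hcompact : IsCompact K :=
    ((isCompact_closedBall _ _).inter_right I.isClosed_range).image_of_continuousOn
      ((continuousOn_extChartAt_symm x).mono fun y hy => (hsub' hy).2.2)
  have hVK : V ⊆ K := fun y hy => ⟨φ y, ⟨ball_subset_closedBall hy.2,
    extChartAt_target_subset_range x (φ.map_source hy.1)⟩, φ.left_inv hy.1⟩
  have hKs : K ⊆ s := by
    rintro _ ⟨y, hy, rfl⟩
    exact (hsub' hy).2.1
  refine ⟨ENNReal.ofReal (r / B), ENNReal.ofReal_pos.2 (by positivity), fun z hz => ?_⟩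
  refine le_immersionDist fun C hC h0 h1 => ?_
  obtain ⟨t, ht, ⟨y, hy, hyt⟩, htV⟩ := exists_mem_diff_of_continuousOn hV hcompact.isClosed hVK
    hC (by rw [h0]; exact ⟨mem_extChartAt_source x, mem_ball_self hr⟩)
    (by rw [h1]; exact fun h => hz (hKs (hVK h)))
  obtain ⟨hyB, -, hyT⟩ := hsub' hy
  have hry : r ≤ dist y (φ x) := by
    by_contra! hlt
    refine htV ?_
    rw [← hyt]
    refine ⟨φ.map_target hyT, ?_⟩
    rw [mem_preimage, φ.right_inv hyT]
    exact hlt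
  refine le_trans ?_ (eVariationOn.edist_le (F ∘ C) ht (left_mem_Icc.2 zero_le_one))
  rw [edist_dist]
  refine ENNReal.ofReal_le_ofReal ?_
  rw [div_le_iff₀' hB]
  have hyB' : ‖y - φ x‖ ≤ B * ‖F (φ.symm y) - F (φ.symm (φ x))‖ := hyB
  rw [hyt, φ.left_inv (mem_extChartAt_source x)] at hyB'
  rw [Function.comp_apply, Function.comp_apply, h0, dist_eq_norm]
  rw [dist_eq_norm] at hry
  exact hry.trans hyB'

end Charts

/-- If `M` is a connected `m`-dimensional manifold-with-boundary of
class `C¹`, `F : M → ℝⁿ` is a `C¹` immersion (`m ≤ n`), and `σ` is the intrinsic distance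
on `M` induced by `F`, then `σ` is finite everywhere, `σ` is a metric on `M`, and the
topology induced by `σ` coincides with the given topology of `M`. -/
theorem immersionDist_metric (m n : ℕ) [NeZero m] (hm : 0 < m) (hn : 0 < n) (hmn : m ≤ n)
    (M : Type) [TopologicalSpace M] [T2Space M] [SecondCountableTopology M]
    [ChartedSpace (EuclideanHalfSpace m) M]
    [HasGroupoid M (contDiffGroupoid 1 (𝓡∂ m))] [ConnectedSpace M]
    (F : M → Euc n)
    (hF : ContMDiff (𝓡∂ m) 𝓘(ℝ, Euc n) 1 F)
    (hImm : ∀ x : M, Function.Injective (mfderiv (𝓡∂ m) 𝓘(ℝ, Euc n) F x)) :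
    (∀ c z : M, immersionDist F c z ≠ ⊤) ∧
    (∀ c z : M, immersionDist F c z = 0 ↔ c = z) ∧
    (∀ c z : M, immersionDist F c z = immersionDist F z c) ∧
    (∀ c y z : M, immersionDist F c z ≤ immersionDist F c y + immersionDist F y z) ∧
    (∀ s : Set M, IsOpen s ↔
      ∀ c ∈ s, ∃ ε : ℝ≥0∞, 0 < ε ∧ {z | immersionDist F c z < ε} ⊆ s) := by
  have hpos (x : M) {s : Set M} (hs : s ∈ 𝓝 x) :
      ∃ ε : ℝ≥0∞, 0 < ε ∧ ∀ z ∉ s, ε ≤ immersionDist F x z :=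
    exists_pos_le_immersionDist ((hF x).mdifferentiableAt one_ne_zero) (hImm x) hs
  have hlt (x : M) {ε : ℝ≥0∞} (hε : 0 < ε) : ∀ᶠ z in 𝓝 x, immersionDist F x z < ε :=
    eventually_immersionDist_lt (hF x) hε
  refine ⟨immersionDist_ne_top_of_eventually fun c =>
      (hlt c ENNReal.zero_lt_top).mono fun _ h => h.ne,
    fun c z => ⟨fun h => ?_, fun h => h ▸ immersionDist_self F c⟩,
    immersionDist_comm F, immersionDist_triangle F, fun s => ⟨fun hs c hc => ?_, fun h => ?_⟩⟩
  · by_contra hne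
    obtain ⟨ε, hε, hle⟩ := hpos c (isOpen_ne.mem_nhds hne)
    exact (h ▸ hle z (by simp)).not_gt hε
  · obtain ⟨ε, hε, hle⟩ := hpos c (hs.mem_nhds hc)
    exact ⟨ε, hε, fun z hz => by_contra fun hzs => (hle z hzs).not_gt hz⟩
  · refine isOpen_iff_mem_nhds.2 fun c hc => ?_
    obtain ⟨ε, hε, hsub⟩ := h c hc
    exact Filter.mem_of_superset (hlt c hε) hsub

end
end

section
/- Suppose X is a closed subset of ℝⁿ and d ∈ [0,∞] denotes the diameter of X with respect to the geodesic distance on X. Then d = sup{ diam f[X] : f ∈ 𝒟(ℝⁿ,ℝ), f ≥ 0, and |Df(x)| ≤ 1 for every x ∈ X }, where f[X] denotes the image of X under f and diam its diameter in ℝ. -/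
open Set Metric
open scoped ENNReal

noncomputable section

/-- Geodesic distance on a subset `X` of `ℝⁿ`: the infimum (possibly `∞`) of the total
variations of continuous paths `C : [0,1] → X` joining the two points. -/
def geodesicDistSet {n : ℕ} (X : Set (Euc n)) (a x : Euc n) : ℝ≥0∞ :=
  ⨅ (C : ℝ → Euc n) (_ : ContinuousOn C (Set.Icc 0 1)) (_ : Set.MapsTo C (Set.Icc 0 1) X)
    (_ : C 0 = a) (_ : C 1 = x), eVariationOn C (Set.Icc 0 1)

/-- The geodesic diameter of `X ⊆ ℝⁿ`. -/
def geodesicDiam {n : ℕ} (X : Set (Euc n)) : ℝ≥0∞ :=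
  ⨆ a ∈ X, ⨆ x ∈ X, geodesicDistSet X a x

open Filter Topology MeasureTheory
open scoped NNReal Convolution ContDiff

/-- Along a path in `X`, a `C¹` function whose derivative has norm at most one on `X`
varies by at most the length of the path. -/
lemma edist_comp_le_eVariationOn {n : ℕ} {X : Set (Euc n)} {f : Euc n → ℝ}
    (hf : ContDiff ℝ 1 f) (hf1 : ∀ x ∈ X, ‖fderiv ℝ f x‖ ≤ 1) {C : ℝ → Euc n}
    (hC : ContinuousOn C (Icc 0 1)) (hCX : MapsTo C (Icc 0 1) X) :
    edist (f (C 0)) (f (C 1)) ≤ eVariationOn C (Icc 0 1) := by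
  have key : ∀ K : ℝ≥0, 1 < K → edist (f (C 0)) (f (C 1)) ≤ K * eVariationOn C (Icc 0 1) := by
    intro K hK
    have hloc : ∀ t : Icc (0 : ℝ) 1, ∃ s ∈ 𝓝 (C t), LipschitzOnWith K f s := fun t =>
      hf.contDiffAt.exists_lipschitzOnWith_of_nnnorm_lt K
        (lt_of_le_of_lt (by exact_mod_cast hf1 _ (hCX t.2)) hK)
    choose s hs hLip using hloc
    have hC' : Continuous fun t : Icc (0 : ℝ) 1 => C t := continuousOn_iff_continuous_domRestrict.1 hC
    obtain ⟨t, ht0, hmono, ⟨m, hm⟩, ht⟩ := exists_monotone_Icc_subset_open_cover_Icc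
      (zero_le_one (α := ℝ)) (c := fun i => (fun t : Icc (0 : ℝ) 1 => C t) ⁻¹' interior (s i))
      (fun i => isOpen_interior.preimage hC')
      (fun i _ => mem_iUnion.2 ⟨i, mem_interior_iff_mem_nhds.2 (hs i)⟩)
    have hind : ∀ k, edist (f (C 0)) (f (C (t k))) ≤
        K * eVariationOn C (Icc 0 1 ∩ Icc 0 (t k : ℝ)) := by
      intro k
      induction k with
      | zero => simp [ht0]
      | succ k ih =>
        have hk : t k ≤ t (k + 1) := hmono (Nat.le_succ k)
        obtain ⟨i, hi⟩ := ht k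
        rw [← eVariationOn.Icc_add_Icc C (t k).2.1 (Subtype.coe_le_coe.2 hk) (t k).2, mul_add]
        refine (edist_triangle _ (f (C (t k))) _).trans (add_le_add ih ?_)
        refine (hLip i (interior_subset (hi ⟨le_rfl, hk⟩))
          (interior_subset (hi ⟨hk, le_rfl⟩))).trans ?_
        gcongr
        exact eVariationOn.edist_le C ⟨(t k).2, le_rfl, hk⟩ ⟨(t (k + 1)).2, hk, le_rfl⟩
    simpa [hm m le_rfl] using hind m
  have hlim : Tendsto (fun K : ℝ≥0 => (K : ℝ≥0∞) * eVariationOn C (Icc 0 1)) (𝓝[>] 1)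
      (𝓝 (1 * eVariationOn C (Icc 0 1))) := by
    refine ENNReal.Tendsto.mul_const ?_ (Or.inl one_ne_zero)
    exact_mod_cast (ENNReal.continuous_coe.tendsto (1 : ℝ≥0)).mono_left nhdsWithin_le_nhds
  rw [one_mul] at hlim
  exact ge_of_tendsto hlim (eventually_mem_nhdsWithin.mono key)

/-- The `t`-values bounding the lengths of `δ`-chains in `U` from `a` to `y`; a chain is encoded
as a map on the line that is `1`-Lipschitz up to the additive error `δ`. -/
def chainLengths {E : Type*} [PseudoMetricSpace E] (U : Set E) (δ : ℝ) (a y : E) : Set ℝ :=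
  {l | 0 ≤ l ∧ ∃ c : ℝ → E, c 0 = a ∧ (∀ t, l ≤ t → c t = y) ∧
    (∀ s t, s ≤ t → dist (c s) (c t) ≤ t - s + δ) ∧ ∀ t, c t ∈ U}

lemma zero_mem_chainLengths {E : Type*} [PseudoMetricSpace E] {U : Set E} {δ : ℝ} (hδ : 0 ≤ δ)
    {a : E} (ha : a ∈ U) : 0 ∈ chainLengths U δ a a :=
  ⟨le_rfl, fun _ => a, rfl, fun _ _ => rfl, fun s t h => by rw [dist_self]; linarith, fun _ => ha⟩

lemma add_dist_mem_chainLengths {E : Type*} [MetricSpace E] {U : Set E} {δ l : ℝ}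
    {a y q : E} (hl : l ∈ chainLengths U δ a y) (hq : q ∈ U) (hyq : dist y q < δ) :
    l + dist y q ∈ chainLengths U δ a q := by
  obtain ⟨hl0, c, hc0, hcl, hcd, hcU⟩ := hl
  have he : 0 ≤ dist y q := dist_nonneg
  refine ⟨by positivity, fun t => if t < l + dist y q then c t else q, ?_, ?_, ?_, ?_⟩
  · by_cases h : 0 < l + dist y q
    · simp [h, hc0]
    · have h1 : l = 0 := by linarith
      have h2 : dist y q = 0 := by linarith
      rw [dist_eq_zero] at h2
      simp [h1, ← h2, ← hc0, hcl 0 h1.le]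
  · intro t ht
    simp [not_lt.2 ht]
  · intro s t hst
    by_cases hs : s < l + dist y q
    · by_cases ht : t < l + dist y q
      · simpa [hs, ht] using hcd s t hst
      · simp only [hs, ht, if_true, if_false]
        rw [not_lt] at ht
        rcases le_total s l with h | h
        · have := hcd s l h
          rw [hcl l le_rfl] at this
          linarith [dist_triangle (c s) y q]
        · rw [hcl s h]
          linarith
    · have ht : ¬ t < l + dist y q := fun h => hs (hst.trans_lt h)
      simp only [hs, ht, if_false, dist_self]
      linarith
  · intro t
    beta_reduce
    split_ifs
    exacts [hcU t, hq]

/-- The length of the shortest `δ`-chain in `U` from `a` to `y`, truncated at `r`. -/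
def chainDist {E : Type*} [PseudoMetricSpace E] (U : Set E) (δ r : ℝ) (a y : E) : ℝ :=
  sInf (insert r (chainLengths U δ a y))

section chainDist

variable {E : Type*} [MetricSpace E] {U : Set E} {δ r : ℝ} {a y q : E}

lemma nonneg_of_mem_insert_chainLengths (hr : 0 ≤ r) {l : ℝ}
    (hl : l ∈ insert r (chainLengths U δ a y)) : 0 ≤ l := by
  rcases hl with rfl | hl
  exacts [hr, hl.1]

lemma bddBelow_insert_chainLengths (hr : 0 ≤ r) :
    BddBelow (insert r (chainLengths U δ a y)) :=
  ⟨0, fun _ => nonneg_of_mem_insert_chainLengths hr⟩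

lemma chainDist_nonneg (hr : 0 ≤ r) : 0 ≤ chainDist U δ r a y :=
  Real.sInf_nonneg fun _ => nonneg_of_mem_insert_chainLengths hr

lemma chainDist_self (hr : 0 ≤ r) (hδ : 0 ≤ δ) (ha : a ∈ U) : chainDist U δ r a a = 0 :=
  le_antisymm (csInf_le (bddBelow_insert_chainLengths hr)
    (mem_insert_of_mem _ (zero_mem_chainLengths hδ ha))) (chainDist_nonneg hr)

lemma chainDist_le_add (hr : 0 ≤ r) (hq : q ∈ U) (hyq : dist y q < δ) :
    chainDist U δ r a q ≤ chainDist U δ r a y + dist y q := by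
  rw [← sub_le_iff_le_add]
  refine le_csInf (insert_nonempty _ _) fun l hl => ?_
  rw [sub_le_iff_le_add]
  rcases hl with rfl | hl
  · exact (csInf_le (bddBelow_insert_chainLengths hr) (mem_insert _ _)).trans
      (le_add_of_nonneg_right dist_nonneg)
  · exact csInf_le (bddBelow_insert_chainLengths hr)
      (mem_insert_of_mem _ (add_dist_mem_chainLengths hl hq hyq))

lemma abs_chainDist_sub_le (hr : 0 ≤ r) (hy : y ∈ U) (hq : q ∈ U) (hyq : dist y q < δ) :
    |chainDist U δ r a y - chainDist U δ r a q| ≤ dist y q := by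
  have h1 := chainDist_le_add (a := a) hr hq hyq
  have h2 := chainDist_le_add (a := a) hr hy (dist_comm y q ▸ hyq)
  rw [dist_comm q y] at h2
  rw [abs_le]
  constructor <;> linarith

lemma le_chainDist (h : ∀ l ∈ chainLengths U δ a y, r ≤ l) : r ≤ chainDist U δ r a y :=
  le_csInf (insert_nonempty _ _) (by rintro l (rfl | hl); exacts [le_rfl, h l hl])

end chainDist

/-- A limit of arbitrarily fine chains of length at most `r` in shrinking neighbourhoods of a
compact set `X` is a path in `X` of length at most `r`. -/
lemma geodesic_of_chains {E : Type*} [MetricSpace E] [ProperSpace E] {X : Set E}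
    (hX : IsClosed X) (hXb : Bornology.IsBounded X) {a x : E} {r : ℝ≥0}
    (h : ∀ δ > 0, ∃ l ∈ chainLengths (thickening δ X) δ a x, l ≤ r) :
    ∃ C : ℝ → E, LipschitzWith r C ∧ (∀ t, C t ∈ X) ∧ C 0 = a ∧ C 1 = x := by
  have hpos : ∀ m : ℕ, (0 : ℝ) < 1 / (m + 1) := fun m => Nat.one_div_pos_of_nat
  choose l hl hlr using fun m : ℕ => h _ (hpos m)
  choose _ c hc0 hcl hcd hcU using hl
  have hK : IsCompact (closure (thickening 1 X)) := hXb.thickening.isCompact_closure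
  have hcK : ∀ m t, c m t ∈ closure (thickening 1 X) := fun m t =>
    subset_closure (thickening_mono ((div_le_one (by positivity)).2 (by simp)) X (hcU m t))
  let 𝒰 : Ultrafilter ℕ := Ultrafilter.of atTop
  have hex : ∀ t : ℝ, ∃ z, Tendsto (fun m => c m t) 𝒰 (𝓝 z) := fun t => by
    obtain ⟨z, -, hz⟩ := hK.ultrafilter_le_nhds (𝒰.map fun m => c m t)
      (tendsto_principal.2 (Eventually.of_forall fun m => hcK m t))
    exact ⟨z, hz⟩
  choose C hC using hex
  have hδ : Tendsto (fun m : ℕ => (1 : ℝ) / (m + 1)) 𝒰 (𝓝 0) :=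
    tendsto_one_div_add_atTop_nhds_zero_nat.mono_left (Ultrafilter.of_le _)
  have hdist : ∀ s t, s ≤ t → dist (C s) (C t) ≤ t - s := fun s t hst => by
    have := hδ.const_add (t - s)
    rw [add_zero] at this
    exact le_of_tendsto_of_tendsto' ((hC s).dist (hC t)) this fun m => hcd m s t hst
  have hLip : LipschitzWith 1 C := LipschitzWith.of_dist_le' (K := 1) (fun s t => by
    rw [one_mul, Real.dist_eq]
    rcases le_total s t with hst | hst
    · rw [abs_sub_comm]; exact (hdist s t hst).trans (le_abs_self _)
    · rw [dist_comm]; exact (hdist t s hst).trans (le_abs_self _)) |>.weaken (by simp)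
  refine ⟨fun t => C (r * t), ?_, fun t => ?_, ?_, ?_⟩
  · refine LipschitzWith.of_dist_le_mul fun s t => ?_
    have := hLip.dist_le_mul (r * s) (r * t)
    rwa [NNReal.coe_one, one_mul, Real.dist_eq, ← mul_sub, abs_mul, NNReal.abs_eq,
      ← Real.dist_eq] at this
  · obtain ⟨z₀, hz₀, -⟩ := mem_thickening_iff.1 (hcU 0 0)
    rw [hX.mem_iff_infDist_zero ⟨z₀, hz₀⟩]
    have h1 : Tendsto (fun m => infDist (c m (r * t)) X) 𝒰 (𝓝 (infDist (C (r * t)) X)) :=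
      ((continuous_infDist_pt X).tendsto _).comp (hC _)
    refine tendsto_nhds_unique h1 (squeeze_zero (fun _ => infDist_nonneg) (fun m => ?_) hδ)
    obtain ⟨z, hz, hd⟩ := mem_thickening_iff.1 (hcU m (r * t))
    exact (infDist_le_dist_of_mem hz).trans hd.le
  · beta_reduce
    rw [mul_zero]
    exact tendsto_nhds_unique (hC 0) (by simp [hc0])
  · beta_reduce
    rw [mul_one]
    refine tendsto_nhds_unique (hC r) ?_
    simp [fun m => hcl m r (hlr m)]

/-- Mollification of a compactly supported function which is `1`-Lipschitz at small scales
near `X`. -/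
lemma exists_smooth_approx {n : ℕ} {X : Set (Euc n)} {h : Euc n → ℝ} {δ ε : ℝ} (hδ : 0 < δ)
    (hε : 0 < ε) (hint : LocallyIntegrable h) (hsupp : HasCompactSupport h) (h0 : ∀ x, 0 ≤ h x)
    (hLip : ∀ x ∈ thickening δ X, ∀ y ∈ thickening δ X, dist x y < δ → |h x - h y| ≤ dist x y) :
    ∃ f : Euc n → ℝ, ContDiff ℝ (⊤ : ℕ∞) f ∧ HasCompactSupport f ∧ (∀ x, 0 ≤ f x) ∧
      (∀ x ∈ X, ‖fderiv ℝ f x‖ ≤ 1) ∧ ∀ x ∈ X, |f x - h x| ≤ ε := by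
  obtain ⟨η, hη, hηlt⟩ : ∃ η > 0, η < min (δ / 2) ε := exists_between (by positivity)
  have hηδ : η < δ / 2 := hηlt.trans_le (min_le_left _ _)
  have hηε : η < ε := hηlt.trans_le (min_le_right _ _)
  let φ : ContDiffBump (0 : Euc n) := ⟨η / 2, η, by positivity, by linarith⟩
  let k : Euc n → ℝ := φ.normed volume
  let f : Euc n → ℝ := k ⋆[ContinuousLinearMap.lsmul ℝ ℝ, volume] h
  have hf_def : ∀ x, f x = ∫ t, k t * h (x - t) := fun x => rfl
  have hsmooth : ContDiff ℝ (⊤ : ℕ∞) f :=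
    φ.hasCompactSupport_normed.contDiff_convolution_left _ φ.contDiff_normed hint
  have hI : ∀ x, Integrable fun t => k t * h (x - t) := fun x =>
    φ.hasCompactSupport_normed.convolutionExists_left (ContinuousLinearMap.lsmul ℝ ℝ)
      φ.continuous_normed hint x
  have hk0 : ∀ t, 0 ≤ k t := φ.nonneg_normed
  have hkout : ∀ t, k t ≠ 0 → ‖t‖ < η := fun t ht => by
    have : t ∈ Function.support k := ht
    rw [φ.support_normed_eq, mem_ball_zero_iff] at this
    exact this
  have hkI : Integrable k := φ.integrable_normed
  have hthick : ∀ x ∈ X, ∀ y, dist y x < δ → y ∈ thickening δ X := fun x hx y hy =>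
    mem_thickening_iff.2 ⟨x, hx, hy⟩
  refine ⟨f, hsmooth, φ.hasCompactSupport_normed.convolution _ hsupp, fun x => ?_, fun x hx => ?_,
    fun x hx => ?_⟩
  · exact integral_nonneg fun t => mul_nonneg (hk0 t) (h0 _)
  · refine ((hsmooth.differentiable (by simp)) x).hasFDerivAt.le_of_lip' zero_le_one ?_
    filter_upwards [ball_mem_nhds x (half_pos hδ)] with y hy
    rw [mem_ball] at hy
    rw [hf_def, hf_def, ← integral_sub (hI y) (hI x), one_mul, ← dist_eq_norm]
    calc ‖∫ t, (k t * h (y - t) - k t * h (x - t))‖ ≤ ∫ t, k t * dist y x := by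
          refine norm_integral_le_of_norm_le (hkI.mul_const _) (Eventually.of_forall fun t => ?_)
          rw [← mul_sub, norm_mul, Real.norm_of_nonneg (hk0 t)]
          by_cases ht : k t = 0
          · simp [ht]
          have htη := hkout t ht
          have hd : dist (y - t) (x - t) = dist y x := dist_sub_right _ _ _
          have hxt : dist (x - t) x < δ / 2 := by
            rw [dist_eq_norm, sub_sub_cancel_left, norm_neg]; linarith
          refine mul_le_mul_of_nonneg_left ?_ (hk0 t)
          rw [← hd, Real.norm_eq_abs]
          refine hLip _ (hthick x hx _ ?_) _ (hthick x hx _ ?_) ?_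
          · linarith [dist_triangle (y - t) (x - t) x]
          · linarith
          · linarith
      _ = dist y x := by rw [integral_mul_const, φ.integral_normed, one_mul]
  · rw [← Real.dist_eq]
    refine φ.dist_normed_convolution_le hint.aestronglyMeasurable fun y hy => ?_
    have hy' : dist y x < η := hy
    rw [Real.dist_eq]
    have := hLip y (hthick x hx y (by linarith)) x (hthick x hx x (by simpa)) (by linarith)
    linarith

lemma exists_smooth_of_not_isBounded {n : ℕ} {X : Set (Euc n)} (hX : ¬ Bornology.IsBounded X)
    (r : ℝ) : ∃ f : Euc n → ℝ, ContDiff ℝ (⊤ : ℕ∞) f ∧ HasCompactSupport f ∧ (∀ x, 0 ≤ f x) ∧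
      (∀ x ∈ X, ‖fderiv ℝ f x‖ ≤ 1) ∧ ∃ a ∈ X, ∃ x ∈ X, r ≤ |f a - f x| := by
  obtain ⟨a, ha⟩ : X.Nonempty := by
    by_contra hne
    exact hX (not_nonempty_iff_eq_empty.1 hne ▸ Bornology.isBounded_empty)
  let h : Euc n → ℝ := fun x => max (|r| + 2 - dist x a) 0
  have hcont : Continuous h := by fun_prop
  have hzero : ∀ x, x ∉ closedBall a (|r| + 2) → h x = 0 := fun x hx => by
    rw [mem_closedBall, not_le] at hx
    exact max_eq_right (by linarith)
  obtain ⟨x, hx, hxa⟩ : ∃ x ∈ X, x ∉ closedBall a (|r| + 2) := by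
    by_contra! hcon
    exact hX (isBounded_closedBall.subset hcon)
  obtain ⟨f, h1, h2, h3, h4, h5⟩ := exists_smooth_approx (X := X) (h := h) one_pos one_pos
    hcont.locallyIntegrable (HasCompactSupport.intro (isCompact_closedBall _ _) hzero)
    (fun _ => le_max_right _ _) (fun x _ y _ _ => by
      refine (abs_max_sub_max_le_abs _ _ _).trans ?_
      rw [sub_sub_sub_cancel_left, dist_comm x y]
      simpa [dist_comm] using abs_dist_sub_le y x a)
  refine ⟨f, h1, h2, h3, h4, a, ha, x, hx, ?_⟩
  have ha' := abs_le.1 (h5 a ha)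
  have hx' := abs_le.1 (h5 x hx)
  rw [hzero x hxa] at hx'
  have hha : h a = |r| + 2 := by simp only [h, dist_self, sub_zero]; exact max_eq_left (by positivity)
  rw [hha] at ha'
  linarith [le_abs_self (f a - f x), le_abs_self r]

lemma exists_smooth_of_chains {n : ℕ} {X : Set (Euc n)} (hXb : Bornology.IsBounded X)
    {a x : Euc n} (ha : a ∈ X) (hx : x ∈ X) {δ r ε : ℝ} (hδ : 0 < δ) (hr : 0 ≤ r) (hε : 0 < ε)
    (h : ∀ l ∈ chainLengths (thickening δ X) δ a x, r ≤ l) :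
    ∃ f : Euc n → ℝ, ContDiff ℝ (⊤ : ℕ∞) f ∧ HasCompactSupport f ∧ (∀ x, 0 ≤ f x) ∧
      (∀ x ∈ X, ‖fderiv ℝ f x‖ ≤ 1) ∧ r - 2 * ε ≤ |f a - f x| := by
  set U := thickening δ X with hU
  have hUo : IsOpen U := isOpen_thickening
  have hUb : Bornology.IsBounded U := hXb.thickening
  have hXU : X ⊆ U := self_subset_thickening hδ X
  let g : Euc n → ℝ := chainDist U δ r a
  have hg : ∀ y ∈ U, ∀ z ∈ U, dist y z < δ → |g y - g z| ≤ dist y z := fun y hy z hz =>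
    abs_chainDist_sub_le hr hy hz
  have hgr : ∀ y, g y ≤ r := fun y =>
    csInf_le (bddBelow_insert_chainLengths hr) (mem_insert _ _)
  have hcont : ContinuousOn g U := by
    refine Metric.continuousOn_iff.2 fun y hy e he => ⟨min δ e, lt_min hδ he, fun z hz hzy => ?_⟩
    exact (hg z hz y hy (hzy.trans_le (min_le_left _ _))).trans_lt
      (hzy.trans_le (min_le_right _ _))
  have hint : LocallyIntegrable (U.indicator g) := by
    refine Integrable.locallyIntegrable ((integrable_indicator_iff hUo.measurableSet).2 ?_)
    have := hUb.measure_lt_top (μ := volume)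
    refine IntegrableOn.of_bound this (hcont.aestronglyMeasurable hUo.measurableSet) r
      (Eventually.of_forall fun y => ?_)
    rw [Real.norm_of_nonneg (chainDist_nonneg hr)]
    exact hgr y
  obtain ⟨f, h1, h2, h3, h4, h5⟩ := exists_smooth_approx (X := X) (h := U.indicator g) hδ hε hint
    (HasCompactSupport.intro hUb.isCompact_closure fun y hy =>
      indicator_of_notMem (fun hyU => hy (subset_closure hyU)) _)
    (fun y => indicator_nonneg (fun _ _ => chainDist_nonneg hr) y)
    (fun y hy z hz hyz => by
      rw [indicator_of_mem hy, indicator_of_mem hz]; exact hg y hy z hz hyz)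
  refine ⟨f, h1, h2, h3, h4, ?_⟩
  have ha' := abs_le.1 (h5 a ha)
  have hx' := abs_le.1 (h5 x hx)
  have hga : g a = 0 := chainDist_self hr hδ.le (hXU ha)
  have hgx : r ≤ g x := le_chainDist h
  rw [indicator_of_mem (hXU ha), hga] at ha'
  rw [indicator_of_mem (hXU hx)] at hx'
  linarith [neg_abs_le (f a - f x)]

lemma edist_le_geodesicDistSet {n : ℕ} {X : Set (Euc n)} {f : Euc n → ℝ}
    (hf : ContDiff ℝ 1 f) (hf1 : ∀ x ∈ X, ‖fderiv ℝ f x‖ ≤ 1) (a x : Euc n) :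
    edist (f a) (f x) ≤ geodesicDistSet X a x := by
  refine le_iInf fun C => le_iInf fun hC => le_iInf fun hCX => le_iInf fun h0 => le_iInf fun h1 => ?_
  rw [← h0, ← h1]
  exact edist_comp_le_eVariationOn hf hf1 hC hCX

lemma geodesicDistSet_le_of_lipschitzWith {n : ℕ} {X : Set (Euc n)} {r : ℝ≥0} {C : ℝ → Euc n}
    (hC : LipschitzWith r C) (hCX : ∀ t, C t ∈ X) : geodesicDistSet X (C 0) (C 1) ≤ r := by
  refine iInf_le_of_le C <| iInf_le_of_le hC.continuous.continuousOn <|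
    iInf_le_of_le (fun t _ => hCX t) <| iInf_le_of_le rfl <| iInf_le_of_le rfl ?_
  refine (hC.lipschitzOnWith (s := univ)).comp_eVariationOn_le (g := id) (s := Icc (0 : ℝ) 1)
    (mapsTo_univ _ _) |>.trans ?_
  have := (monotone_id.monotoneOn (Icc (0 : ℝ) 1)).eVariationOn_eq
    (left_mem_Icc.2 zero_le_one) (right_mem_Icc.2 zero_le_one)
  rw [inter_self] at this
  simp [this]

lemma exists_smooth_of_lt_geodesicDistSet {n : ℕ} {X : Set (Euc n)} (hX : IsClosed X)
    {a x : Euc n} (ha : a ∈ X) (hx : x ∈ X) {r : ℝ≥0} (hr : r < geodesicDistSet X a x) :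
    ∃ f : Euc n → ℝ, ContDiff ℝ (⊤ : ℕ∞) f ∧ HasCompactSupport f ∧ (∀ x, 0 ≤ f x) ∧
      (∀ x ∈ X, ‖fderiv ℝ f x‖ ≤ 1) ∧ ∃ a ∈ X, ∃ x ∈ X, (r : ℝ) ≤ |f a - f x| := by
  by_cases hXb : Bornology.IsBounded X
  · obtain ⟨r', hrr', hr'⟩ := ENNReal.lt_iff_exists_nnreal_btwn.1 hr
    have hrr'' : (r : ℝ) < r' := by exact_mod_cast hrr'
    obtain ⟨δ, hδ, hl⟩ : ∃ δ > 0, ∀ l ∈ chainLengths (thickening δ X) δ a x, (r' : ℝ) ≤ l := by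
      by_contra! hcon
      obtain ⟨C, hC, hCX, rfl, rfl⟩ := geodesic_of_chains hX hXb fun δ hδ =>
        (hcon δ hδ).imp fun l hl => ⟨hl.1, hl.2.le⟩
      exact hr'.not_ge (geodesicDistSet_le_of_lipschitzWith hC hCX)
    obtain ⟨f, h1, h2, h3, h4, h5⟩ := exists_smooth_of_chains hXb ha hx hδ r'.coe_nonneg
      (half_pos (sub_pos.2 hrr'')) hl
    exact ⟨f, h1, h2, h3, h4, a, ha, x, hx, by linarith⟩
  · exact exists_smooth_of_not_isBounded hXb r

/-- For a closed subset `X` of `ℝⁿ`, the geodesic diameter `d` of `X`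
equals the supremum of `diam f[X]` over all nonnegative smooth compactly supported
functions `f : ℝⁿ → ℝ` with `|Df(x)| ≤ 1` for every `x ∈ X`. -/
theorem geodesicDiam_eq_sup_diam_image {n : ℕ} (X : Set (Euc n)) (hX : IsClosed X) :
    geodesicDiam X =
      ⨆ (f : Euc n → ℝ) (_ : ContDiff ℝ (⊤ : ℕ∞) f) (_ : HasCompactSupport f)
        (_ : ∀ x, 0 ≤ f x) (_ : ∀ x ∈ X, ‖fderiv ℝ f x‖ ≤ 1),
        ENNReal.ofReal (Metric.diam (f '' X)) := by
  apply le_antisymm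
  · refine iSup₂_le fun a ha => iSup₂_le fun x hx => ENNReal.le_of_forall_nnreal_lt fun r hr => ?_
    obtain ⟨f, h1, h2, h3, h4, b, hb, y, hy, h5⟩ :=
      exists_smooth_of_lt_geodesicDistSet hX ha hx hr
    refine le_iSup_of_le f <| le_iSup_of_le h1 <| le_iSup_of_le h2 <| le_iSup_of_le h3 <|
      le_iSup_of_le h4 ?_
    have hbdd : Bornology.IsBounded (f '' X) :=
      (h2.isCompact_range h1.continuous).isBounded.subset (image_subset_range f X)
    rw [← ENNReal.ofReal_coe_nnreal]
    exact ENNReal.ofReal_le_ofReal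
      (h5.trans (dist_le_diam_of_mem hbdd (mem_image_of_mem f hb) (mem_image_of_mem f hy)))
  · refine iSup_le fun f => iSup_le fun h1 => iSup_le fun h2 => iSup_le fun h3 => iSup_le fun h4 => ?_
    refine ENNReal.ofReal_toReal_le.trans (ediam_le ?_)
    rintro _ ⟨a, ha, rfl⟩ _ ⟨x, hx, rfl⟩
    exact (edist_le_geodesicDistSet (h1.of_le (by exact_mod_cast le_top)) h4 a x).trans
      (le_iSup₂_of_le a ha (le_iSup₂_of_le x hx le_rfl))

end
end

section
/- Suppose X is a locally compact Hausdorff space, φ is a Radon (outer) measure over X, Y is a separable metric space, f : X → Y is a φ-measurable function, and there exist countably many compact subsets K₁, K₂, … of X with φ( X ∖ ⋃_i K_i ) = 0. Then the push-forward f_# φ, defined by (f_# φ)(B) = φ( f⁻¹[B] ) for every B ⊆ Y, is a Borel regular outer measure over Y: every Borel subset of Y is Carathéodory-measurable with respect to f_# φ, and for every B ⊆ Y there exists a Borel set B′ ⊇ B with (f_# φ)(B′) = (f_# φ)(B). -/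
open Set MeasureTheory
open scoped ENNReal

noncomputable section

namespace MeasureTheory.OuterMeasure

variable {X Y : Type*} [TopologicalSpace X] [T2Space X] {φ : OuterMeasure X}

/-- A Carathéodory measurable subset of a compact set is approximated from inside by compact
sets, provided that the outer measure is outer regular and finite on compact sets. -/
theorem exists_isCompact_subset_diff_le
    (hm : ∀ s : Set X, MeasurableSet[borel X] s → φ.IsCaratheodory s)
    (hfin : ∀ K : Set X, IsCompact K → φ K < ⊤)
    (hout : ∀ A : Set X, φ A = ⨅ (V : Set X) (_ : IsOpen V) (_ : A ⊆ V), φ V)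
    {L S : Set X} (hL : IsCompact L) (hSL : S ⊆ L) (hS : φ.IsCaratheodory S)
    {ε : ℝ≥0∞} (hε : ε ≠ 0) :
    ∃ P ⊆ S, IsCompact P ∧ φ (S \ P) ≤ ε := by
  have hLm : φ.IsCaratheodory L :=
    hm L (by borelize X; exact hL.isClosed.measurableSet)
  have hT : φ.IsCaratheodory (L \ S) := φ.isCaratheodory_sdiff hLm hS
  have hTfin : φ (L \ S) ≠ ⊤ := ((φ.mono sdiff_subset).trans_lt (hfin L hL)).ne
  have hlt : φ (L \ S) < φ (L \ S) + ε := ENNReal.lt_add_right hTfin hε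
  rw [hout (L \ S)] at hlt
  simp only [iInf_lt_iff] at hlt
  obtain ⟨V, hV, hTV, hlt⟩ := hlt
  rw [← hout (L \ S), hT V, inter_eq_self_of_subset_right hTV] at hlt
  refine ⟨L \ V, fun x hx ↦ ?_, hL.diff hV, ?_⟩
  · by_contra hxS
    exact hx.2 (hTV ⟨hx.1, hxS⟩)
  · refine le_trans (φ.mono fun x hx ↦ ?_) (lt_of_add_lt_add_left hlt).le
    exact ⟨by_contra fun hxV ↦ hx.2 ⟨hSL hx.1, hxV⟩, fun h ↦ h.2 hx.1⟩

/-- Lusin's theorem on a compact set, for maps into a second countable space. -/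
theorem exists_isCompact_continuousOn_diff_le
    [TopologicalSpace Y] [SecondCountableTopology Y]
    (hm : ∀ s : Set X, MeasurableSet[borel X] s → φ.IsCaratheodory s)
    (hfin : ∀ K : Set X, IsCompact K → φ K < ⊤)
    (hout : ∀ A : Set X, φ A = ⨅ (V : Set X) (_ : IsOpen V) (_ : A ⊆ V), φ V)
    {f : X → Y} (hf : ∀ U : Set Y, IsOpen U → φ.IsCaratheodory (f ⁻¹' U))
    {L : Set X} (hL : IsCompact L) {ε : ℝ≥0∞} (hε : ε ≠ 0) :
    ∃ D ⊆ L, IsCompact D ∧ ContinuousOn f D ∧ φ (L \ D) ≤ ε := by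
  have hLm : φ.IsCaratheodory L :=
    hm L (by borelize X; exact hL.isClosed.measurableSet)
  let b := TopologicalSpace.countableBasis Y
  have hb : TopologicalSpace.IsTopologicalBasis b := TopologicalSpace.isBasis_countableBasis Y
  have : Countable b := (TopologicalSpace.countable_countableBasis Y).to_subtype
  obtain ⟨δ, hδ, hsum⟩ := ENNReal.exists_pos_sum_of_countable' hε b
  have hP (U : b) := exists_isCompact_subset_diff_le hm hfin hout hL inter_subset_left
    (φ.isCaratheodory_inter hLm (hf U (hb.isOpen U.2))) (ENNReal.half_pos (hδ U).ne').ne'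
  have hQ (U : b) := exists_isCompact_subset_diff_le hm hfin hout hL sdiff_subset
    (φ.isCaratheodory_sdiff hLm (hf U (hb.isOpen U.2))) (ENNReal.half_pos (hδ U).ne').ne'
  choose P hPs hPc hPle using hP
  choose Q hQs hQc hQle using hQ
  refine ⟨L ∩ ⋂ U, (P U ∪ Q U), inter_subset_left,
    hL.inter_right (isClosed_iInter fun U ↦ ((hPc U).union (hQc U)).isClosed), ?_, ?_⟩
  · intro x hx
    rw [ContinuousWithinAt, hb.nhds_hasBasis.tendsto_right_iff]
    rintro U ⟨hU, hxU⟩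
    have hxQ : x ∉ Q ⟨U, hU⟩ := fun h ↦ (hQs _ h).2 hxU
    filter_upwards [self_mem_nhdsWithin,
      mem_nhdsWithin_of_mem_nhds ((hQc ⟨U, hU⟩).isClosed.isOpen_compl.mem_nhds hxQ)] with z hz hzQ
    exact (hPs _ ((mem_iInter.1 hz.2 ⟨U, hU⟩).resolve_right hzQ)).2
  · have hsub : L \ (L ∩ ⋂ U, (P U ∪ Q U)) ⊆
        ⋃ U : b, ((L ∩ f ⁻¹' U) \ P U) ∪ ((L \ f ⁻¹' U) \ Q U) := by
      rintro x ⟨hxL, hx⟩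
      obtain ⟨U, hU⟩ : ∃ U, x ∉ P U ∪ Q U := by
        by_contra! h
        exact hx ⟨hxL, mem_iInter.2 h⟩
      rw [mem_union, not_or] at hU
      by_cases hxU : x ∈ f ⁻¹' U
      · exact mem_iUnion.2 ⟨U, .inl ⟨⟨hxL, hxU⟩, hU.1⟩⟩
      · exact mem_iUnion.2 ⟨U, .inr ⟨⟨hxL, hxU⟩, hU.2⟩⟩
    calc φ (L \ (L ∩ ⋂ U, (P U ∪ Q U)))
      _ ≤ ∑' U : b, φ (((L ∩ f ⁻¹' U) \ P U) ∪ ((L \ f ⁻¹' U) \ Q U)) :=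
        (φ.mono hsub).trans (measure_iUnion_le _)
      _ ≤ ∑' U : b, δ U := ENNReal.tsum_le_tsum fun U ↦
        (measure_union_le _ _).trans ((add_le_add (hPle U) (hQle U)).trans_eq
          (ENNReal.add_halves _))
      _ ≤ ε := hsum.le

/-- If `φ` is concentrated on a `σ`-compact set, then every open neighbourhood of `f ⁻¹' B`
contains, up to a null set, the preimage of a Borel set containing `B`. -/
theorem exists_borel_superset_preimage_le
    [TopologicalSpace Y] [T2Space Y] [SecondCountableTopology Y]
    (hm : ∀ s : Set X, MeasurableSet[borel X] s → φ.IsCaratheodory s)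
    (hfin : ∀ K : Set X, IsCompact K → φ K < ⊤)
    (hout : ∀ A : Set X, φ A = ⨅ (V : Set X) (_ : IsOpen V) (_ : A ⊆ V), φ V)
    {f : X → Y} (hf : ∀ U : Set Y, IsOpen U → φ.IsCaratheodory (f ⁻¹' U))
    {K : ℕ → Set X} (hK : ∀ i, IsCompact (K i)) (hKae : φ (univ \ ⋃ i, K i) = 0)
    {B : Set Y} {V : Set X} (hV : IsOpen V) (hBV : f ⁻¹' B ⊆ V) :
    ∃ B' : Set Y, B ⊆ B' ∧ MeasurableSet[borel Y] B' ∧ φ (f ⁻¹' B') ≤ φ V := by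
  have hD (i j : ℕ) := exists_isCompact_continuousOn_diff_le hm hfin hout hf ((hK i).diff hV)
    (ENNReal.inv_ne_zero.2 (ENNReal.natCast_ne_top j))
  choose D hDs hDc hDf hDle using hD
  have hnull (i : ℕ) : φ ((K i \ V) \ ⋃ j, D i j) = 0 := by
    refine le_antisymm (le_of_forall_gt fun ε hε ↦ ?_) zero_le
    obtain ⟨j, hj⟩ := ENNReal.exists_inv_nat_lt hε.ne'
    exact ((φ.mono (sdiff_subset_sdiff_right (subset_iUnion _ j))).trans (hDle i j)).trans_lt hj
  refine ⟨(⋃ i, ⋃ j, f '' D i j)ᶜ, ?_, ?_, ?_⟩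
  · intro y hy hy'
    simp only [mem_iUnion] at hy'
    obtain ⟨i, j, x, hx, rfl⟩ := hy'
    exact (hDs i j hx).2 (hBV hy)
  · borelize Y
    exact (MeasurableSet.iUnion fun i ↦ MeasurableSet.iUnion fun j ↦
      ((hDc i j).image_of_continuousOn (hDf i j)).isClosed.measurableSet).compl
  · have hsub : f ⁻¹' (⋃ i, ⋃ j, f '' D i j)ᶜ ⊆
        V ∪ ((univ \ ⋃ i, K i) ∪ ⋃ i, ((K i \ V) \ ⋃ j, D i j)) := by
      intro x hx
      by_cases hxV : x ∈ V
      · exact .inl hxV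
      by_cases hxK : x ∈ ⋃ i, K i
      · obtain ⟨i, hi⟩ := mem_iUnion.1 hxK
        refine .inr (.inr (mem_iUnion.2 ⟨i, ⟨hi, hxV⟩, fun hxD ↦ hx ?_⟩))
        obtain ⟨j, hj⟩ := mem_iUnion.1 hxD
        exact mem_iUnion.2 ⟨i, mem_iUnion.2 ⟨j, x, hj, rfl⟩⟩
      · exact .inr (.inl ⟨mem_univ x, hxK⟩)
    calc φ (f ⁻¹' (⋃ i, ⋃ j, f '' D i j)ᶜ)
      _ ≤ φ V + φ ((univ \ ⋃ i, K i) ∪ ⋃ i, ((K i \ V) \ ⋃ j, D i j)) :=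
        (φ.mono hsub).trans (measure_union_le _ _)
      _ = φ V := by
        rw [measure_union_null hKae (measure_iUnion_null hnull), add_zero]

end MeasureTheory.OuterMeasure

/-- Suppose `X` is a locally compact Hausdorff space, `φ` is a Radon outer
measure over `X` (in Federer's sense: Borel regular, finite on compact sets, inner regular
on open sets by compact sets, and outer regular by open sets), `Y` is a separable metric
space, `f : X → Y` is `φ`-measurable, and `X` is `φ`-almost equal to a countable union of
compact sets.  Then the push-forward `B ↦ φ (f ⁻¹' B)` is a Borel regular outer measure
over `Y`: every Borel subset of `Y` is Carathéodory-measurable with respect to it, and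
every subset of `Y` is contained in a Borel set of equal push-forward measure. -/
theorem pushforward_borelRegular {X Y : Type*} [TopologicalSpace X] [LocallyCompactSpace X]
    [T2Space X] [MetricSpace Y] [TopologicalSpace.SeparableSpace Y]
    (φ : MeasureTheory.OuterMeasure X)
    (hBorelMeasurable : ∀ s : Set X, MeasurableSet[borel X] s → φ.IsCaratheodory s)
    (hBorelRegular : ∀ A : Set X, ∃ B : Set X, A ⊆ B ∧ MeasurableSet[borel X] B ∧ φ B = φ A)
    (hCompactFinite : ∀ K : Set X, IsCompact K → φ K < ⊤)
    (hInnerRegular : ∀ V : Set X, IsOpen V →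
      φ V = ⨆ (K : Set X) (_ : K ⊆ V) (_ : IsCompact K), φ K)
    (hOuterRegular : ∀ A : Set X, φ A = ⨅ (V : Set X) (_ : IsOpen V) (_ : A ⊆ V), φ V)
    (f : X → Y)
    (hf : ∀ U : Set Y, IsOpen U → φ.IsCaratheodory (f ⁻¹' U))
    (K : ℕ → Set X) (hK : ∀ i, IsCompact (K i))
    (hKae : φ (Set.univ \ ⋃ i, K i) = 0) :
    (∀ B : Set Y, MeasurableSet[borel Y] B → ∀ t : Set Y,
        φ (f ⁻¹' t) = φ (f ⁻¹' (t ∩ B)) + φ (f ⁻¹' (t \ B))) ∧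
    (∀ B : Set Y, ∃ B' : Set Y, B ⊆ B' ∧ MeasurableSet[borel Y] B' ∧
        φ (f ⁻¹' B') = φ (f ⁻¹' B)) := by
  refine ⟨fun B hB t ↦ ?_, fun B ↦ ?_⟩
  · have hle : borel Y ≤ φ.caratheodory.map f := MeasurableSpace.generateFrom_le hf
    exact hle B hB (f ⁻¹' t)
  · by_cases htop : φ (f ⁻¹' B) = ⊤
    · exact ⟨univ, subset_univ B, @MeasurableSet.univ Y (borel Y),
        le_antisymm (htop ▸ le_top) (φ.mono (preimage_mono (subset_univ B)))⟩
    have hex (n : ℕ) : ∃ B' : Set Y, B ⊆ B' ∧ MeasurableSet[borel Y] B' ∧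
        φ (f ⁻¹' B') ≤ φ (f ⁻¹' B) + (n : ℝ≥0∞)⁻¹ := by
      have hlt : φ (f ⁻¹' B) < φ (f ⁻¹' B) + (n : ℝ≥0∞)⁻¹ :=
        ENNReal.lt_add_right htop (ENNReal.inv_ne_zero.2 (ENNReal.natCast_ne_top n))
      rw [hOuterRegular (f ⁻¹' B)] at hlt
      simp only [iInf_lt_iff] at hlt
      obtain ⟨V, hV, hBV, hlt⟩ := hlt
      rw [← hOuterRegular (f ⁻¹' B)] at hlt
      have : SecondCountableTopology Y := UniformSpace.secondCountable_of_separable Y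
      obtain ⟨B', hBB', hB', hle⟩ := OuterMeasure.exists_borel_superset_preimage_le
        hBorelMeasurable hCompactFinite hOuterRegular hf hK hKae hV hBV
      exact ⟨B', hBB', hB', hle.trans hlt.le⟩
    choose B' hBB' hB' hle using hex
    refine ⟨⋂ n, B' n, subset_iInter hBB', @MeasurableSet.iInter Y ℕ (borel Y) _ _ hB',
      le_antisymm ?_ (φ.mono (preimage_mono (subset_iInter hBB')))⟩
    refine ENNReal.le_of_forall_pos_le_add fun ε hε _ ↦ ?_
    obtain ⟨n, hn⟩ := ENNReal.exists_inv_nat_lt (ENNReal.coe_pos.2 hε).ne'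
    exact (φ.mono (preimage_mono (iInter_subset B' n))).trans
      ((hle n).trans (add_le_add le_rfl hn.le))

end
end

section
/- Suppose U is an open subset of ℝⁿ and A is a relatively closed subset of U. Then there exists a C^∞ function f : U → ℝ with f ≥ 0 and A = { x ∈ U : f(x) = 0 }. -/
open Set

noncomputable section

/-- If `U` is an open subset of `ℝⁿ` and `A` is a relatively closed
subset of `U`, then there exists a `C^∞` function `f : U → ℝ` with `f ≥ 0` and
`A = {x ∈ U : f x = 0}`. -/
theorem exists_smooth_nonneg_zero_set {n : ℕ} (U A : Set (Euc n)) (hU : IsOpen U)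
    (hAU : A ⊆ U) (hA : ∃ C : Set (Euc n), IsClosed C ∧ A = C ∩ U) :
    ∃ f : Euc n → ℝ, ContDiffOn ℝ (⊤ : ℕ∞) f U ∧ (∀ x ∈ U, 0 ≤ f x) ∧
      A = {x ∈ U | f x = 0} := by
  obtain ⟨C, hC, rfl⟩ := hA
  obtain ⟨f, hf_supp, hf_smooth, hf_range⟩ :=
    hC.isOpen_compl.exists_contDiff_support_eq (n := (⊤ : ℕ∞))
  refine ⟨f, hf_smooth.contDiffOn, fun x _ => (hf_range (mem_range_self x)).1, ?_⟩
  ext x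
  have hx : f x ≠ 0 ↔ x ∉ C := Set.ext_iff.mp hf_supp x
  simp only [mem_inter_iff, mem_ofPred_eq]
  tauto

end
end

section
/- Suppose m and n are positive integers with m ≤ n, M is an m-dimensional submanifold-with-boundary of ℝⁿ of class C¹, and σ denotes the intrinsic distance on M, i.e. σ(z,ζ) is the infimum of the total variations of continuous paths C : [0,1] → M with C(0) = z and C(1) = ζ. Then for every c ∈ M and every λ > 1 there exists δ > 0 such that σ(z,ζ) ≤ λ |z − ζ| whenever z, ζ ∈ M ∩ B(c,δ), where B(c,δ) is the closed Euclidean ball. -/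
open Set Metric
open scoped ENNReal

noncomputable section

/-- The local model for an `m`-dimensional submanifold-with-boundary of `ℝⁿ`:
`{y ∈ ℝᵐ : y_{m-1} ≥ 0} × {0}^{n-m}` (coordinates indexed from `0`). -/
def halfModel (m n : ℕ) : Set (Euc n) :=
  {y | (∀ i : Fin n, m ≤ (i : ℕ) → y i = 0) ∧ ∀ i : Fin n, (i : ℕ) = m - 1 → 0 ≤ y i}

/-- `ψ` is a `C^k` diffeomorphism of the open set `V ⊆ ℝⁿ` onto an open subset of `ℝⁿ`
mapping `V ∩ M` onto `ψ(V) ∩ Mod`. -/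
def IsChartOn (k : ℕ∞) {n : ℕ} (Mod M V : Set (Euc n)) (ψ : Euc n → Euc n) : Prop :=
  IsOpen V ∧ ContDiffOn ℝ k ψ V ∧ IsOpen (ψ '' V) ∧ Set.InjOn ψ V ∧
    (∃ φ : Euc n → Euc n, ContDiffOn ℝ k φ (ψ '' V) ∧ ∀ x ∈ V, φ (ψ x) = x) ∧
    ψ '' (V ∩ M) = (ψ '' V) ∩ Mod

/-- `M ⊆ ℝⁿ` is an `m`-dimensional submanifold-with-boundary of class `C^k` of `ℝⁿ`. -/
def IsSubmanifoldBdry (k : ℕ∞) (m : ℕ) {n : ℕ} (M : Set (Euc n)) : Prop :=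
  ∀ x ∈ M, ∃ V ψ, x ∈ V ∧ IsChartOn k (halfModel m n) M V ψ

lemma convex_halfModel (m n : ℕ) : Convex ℝ (halfModel m n) := by
  intro x hx y hy a b ha hb _
  refine ⟨fun i hi => ?_, fun i hi => ?_⟩
  · simp [hx.1 i hi, hy.1 i hi]
  · have h1 := hx.2 i hi
    have h2 := hy.2 i hi
    simp only [PiLp.add_apply, PiLp.smul_apply, smul_eq_mul]
    positivity

/-- A path that is Lipschitz with constant `K` on the unit interval bounds the intrinsic
distance of its endpoints by `K`. -/
lemma geodesicDistSet_le_of_lipschitzOnWith {n : ℕ} {X : Set (Euc n)} {C : ℝ → Euc n}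
    {K : NNReal} (hC : LipschitzOnWith K C (Set.Icc 0 1))
    (hX : Set.MapsTo C (Set.Icc 0 1) X) :
    geodesicDistSet X (C 0) (C 1) ≤ K := by
  have h0 : geodesicDistSet X (C 0) (C 1) ≤ eVariationOn C (Set.Icc 0 1) :=
    iInf_le_of_le C <| iInf_le_of_le hC.continuousOn <| iInf_le_of_le hX <|
      iInf_le_of_le rfl <| iInf_le_of_le rfl le_rfl
  refine h0.trans ?_
  have h1 : eVariationOn (C ∘ id) (Set.Icc 0 1) ≤ K * eVariationOn (id : ℝ → ℝ) (Set.Icc 0 1) :=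
    hC.comp_eVariationOn_le (fun x hx => hx)
  have h2 : eVariationOn (id : ℝ → ℝ) (Set.Icc 0 1) ≤ 1 := by simp
  calc eVariationOn C (Set.Icc 0 1) ≤ K * eVariationOn (id : ℝ → ℝ) (Set.Icc 0 1) := h1
    _ ≤ K * 1 := by gcongr
    _ = K := mul_one _

/-- If `f` is `ε`-close to the linear map `A` on a convex set containing `x` and `y`,
then `f` is Lipschitz along the segment from `x` to `y` with constant `‖f y - f x‖ + 2 ε ‖y - x‖`. -/
lemma ApproximatesLinearOn.norm_lineMap_sub_le {E F : Type*} [NormedAddCommGroup E]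
    [NormedSpace ℝ E] [NormedAddCommGroup F] [NormedSpace ℝ F] {f : E → F} {A : E →L[ℝ] F}
    {s : Set E} {ε : NNReal} (hf : ApproximatesLinearOn f A s ε) (hs : Convex ℝ s) {x y : E}
    (hx : x ∈ s) (hy : y ∈ s) {t u : ℝ} (ht : t ∈ Set.Icc (0 : ℝ) 1)
    (hu : u ∈ Set.Icc (0 : ℝ) 1) :
    ‖f (AffineMap.lineMap x y t) - f (AffineMap.lineMap x y u)‖
      ≤ (‖f y - f x‖ + 2 * ε * ‖y - x‖) * |t - u| := by
  have h1 := hf _ (hs.lineMap_mem hx hy ht) _ (hs.lineMap_mem hx hy hu)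
  have h2 := hf _ hy _ hx
  have e : (AffineMap.lineMap x y t - AffineMap.lineMap x y u : E) = (t - u) • (y - x) := by
    simp only [AffineMap.lineMap_apply_module']
    module
  rw [e, map_smul, norm_smul, Real.norm_eq_abs] at h1
  have h3 : ‖A (y - x)‖ ≤ ‖f y - f x‖ + ε * ‖y - x‖ := by
    have := norm_sub_norm_le (A (y - x)) (f y - f x)
    rw [norm_sub_rev (A (y - x))] at this
    linarith
  have h4 := norm_sub_norm_le (f (AffineMap.lineMap x y t) - f (AffineMap.lineMap x y u))
    ((t - u) • A (y - x))
  rw [norm_smul, Real.norm_eq_abs] at h4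
  have h5 := mul_le_mul_of_nonneg_left h3 (abs_nonneg (t - u))
  linarith

/-- For an `m`-dimensional `C¹` submanifold-with-boundary `M` of `ℝⁿ`
and its intrinsic distance `σ`, for every `c ∈ M` and `λ > 1` there exists `δ > 0` such
that `σ(z,ζ) ≤ λ |z − ζ|` whenever `z, ζ ∈ M ∩ B(c,δ)`. -/
theorem intrinsicDist_le_of_near {m n : ℕ} (hm : 0 < m) (hmn : m ≤ n) (M : Set (Euc n))
    (hM : IsSubmanifoldBdry 1 m M) :
    ∀ c ∈ M, ∀ lam : ℝ, 1 < lam → ∃ δ : ℝ, 0 < δ ∧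
      ∀ z ∈ M ∩ Metric.closedBall c δ, ∀ ζ ∈ M ∩ Metric.closedBall c δ,
        geodesicDistSet M z ζ ≤ ENNReal.ofReal (lam * dist z ζ) := by
  intro c hc lam hlam
  obtain ⟨V, ψ, hcV, hV, hψ, hW, -, ⟨φ, hφ, hφψ⟩, himg⟩ := hM c hc
  have hpW : ψ '' V ∈ nhds (ψ c) := hW.mem_nhds (mem_image_of_mem ψ hcV)
  have hψc : ContDiffAt ℝ 1 ψ c := hψ.contDiffAt (hV.mem_nhds hcV)
  have hφc : ContDiffAt ℝ 1 φ (ψ c) := hφ.contDiffAt hpW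
  obtain ⟨K, U, hU, hK⟩ := hψc.exists_lipschitzOnWith
  obtain ⟨ε, hε, hεK⟩ : ∃ ε : NNReal, 0 < ε ∧ 1 + 2 * (ε : ℝ) * K ≤ lam := by
    have hlam' : 0 < lam - 1 := sub_pos.2 hlam
    have hd : 0 < 2 * (K : ℝ) + 1 := by positivity
    refine ⟨((lam - 1) / (2 * K + 1)).toNNReal, Real.toNNReal_pos.2 (by positivity), ?_⟩
    · have h : (lam - 1) / (2 * (K : ℝ) + 1) * (2 * K + 1) = lam - 1 := div_mul_cancel₀ _ hd.ne'
      have h' : 0 ≤ (lam - 1) / (2 * (K : ℝ) + 1) := by positivity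
      rw [Real.coe_toNNReal _ h']
      nlinarith
  obtain ⟨s, hs, hφs⟩ := (hφc.hasStrictFDerivAt one_ne_zero).approximates_deriv_on_nhds
    (c := ε) (Or.inr hε)
  obtain ⟨r, hr, hrs⟩ := Metric.mem_nhds_iff.1 (Filter.inter_mem hs hpW)
  have hball := hφs.mono_set (hrs.trans inter_subset_left)
  have hpre : ψ ⁻¹' Metric.ball (ψ c) r ∈ nhds c :=
    hψc.continuousAt.preimage_mem_nhds (Metric.ball_mem_nhds _ hr)
  obtain ⟨δ, hδ, hδs⟩ := Metric.nhds_basis_closedBall.mem_iff.1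
    (Filter.inter_mem (Filter.inter_mem hpre hU) (hV.mem_nhds hcV))
  refine ⟨δ, hδ, fun z hz ζ hζ => ?_⟩
  obtain ⟨⟨hzr, hzU⟩, hzV⟩ := hδs hz.2
  obtain ⟨⟨hζr, hζU⟩, hζV⟩ := hδs hζ.2
  replace hzr : ψ z ∈ Metric.ball (ψ c) r := hzr
  replace hζr : ψ ζ ∈ Metric.ball (ψ c) r := hζr
  have hmod : ∀ w ∈ V, w ∈ M → ψ w ∈ halfModel m n := fun w hwV hwM =>
    (himg.subset (mem_image_of_mem ψ ⟨hwV, hwM⟩)).2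
  have hLip : LipschitzOnWith (lam * dist z ζ).toNNReal
      (fun t : ℝ => φ (AffineMap.lineMap (ψ z) (ψ ζ) t)) (Set.Icc 0 1) := by
    refine LipschitzOnWith.of_dist_le_mul fun t ht u hu => ?_
    rw [Real.coe_toNNReal _ (by positivity), dist_eq_norm, Real.dist_eq]
    refine (hball.norm_lineMap_sub_le (convex_ball _ _) hzr hζr ht hu).trans ?_
    gcongr
    rw [hφψ z hzV, hφψ ζ hζV, ← dist_eq_norm, ← dist_eq_norm, dist_comm ζ z]
    have h1 := hK.dist_le_mul ζ hζU z hzU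
    rw [dist_comm ζ z] at h1
    calc dist z ζ + 2 * ε * dist (ψ ζ) (ψ z)
        ≤ dist z ζ + 2 * ε * (K * dist z ζ) := by gcongr
      _ = (1 + 2 * ε * K) * dist z ζ := by ring
      _ ≤ lam * dist z ζ := by gcongr
  have hmaps : Set.MapsTo (fun t : ℝ => φ (AffineMap.lineMap (ψ z) (ψ ζ) t))
      (Set.Icc 0 1) M := by
    intro t ht
    have hW' := (hrs ((convex_ball (ψ c) r).lineMap_mem hzr hζr ht)).2
    have hmem := (convex_halfModel m n).lineMap_mem (hmod z hzV hz.1) (hmod ζ hζV hζ.1) ht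
    obtain ⟨w, ⟨hwV, hwM⟩, hw⟩ := himg.superset ⟨hW', hmem⟩
    simpa only [← hw, hφψ w hwV] using hwM
  have h := geodesicDistSet_le_of_lipschitzOnWith hLip hmaps
  simpa only [AffineMap.lineMap_apply_zero, AffineMap.lineMap_apply_one, hφψ z hzV,
    hφψ ζ hζV, ENNReal.ofReal] using h

end
end

section
/- Suppose n ≥ 2 is an integer, a_k < b_k are real numbers for k = 1, …, n, ε > 0, Q = { x ∈ ℝⁿ : a_k ≤ x•e_k ≤ b_k for k = 1, …, n } is the closed box, and U = Q ∩ { x : dist(x, S) < ε }, where S = Q ∩ { χ : card{ k : χ•e_k = a_k or χ•e_k = b_k } ≥ 2 } is the set of points of Q lying on at least two faces and e₁, …, e_n is the standard basis of ℝⁿ. Then there exists a properly embedded n-dimensional submanifold-with-boundary M of ℝⁿ of class C^∞ such that ∂M is connected and M ∖ U = Q ∖ U. -/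
open Set Metric
open scoped ENNReal Topology

noncomputable section

/-- The manifold boundary `∂M` of an `m`-dimensional submanifold-with-boundary of `ℝⁿ`. -/
def mfdBoundary (k : ℕ∞) (m : ℕ) {n : ℕ} (M : Set (Euc n)) : Set (Euc n) :=
  {x | x ∈ M ∧ ∃ V ψ, x ∈ V ∧ IsChartOn k (halfModel m n) M V ψ ∧
    ∀ i : Fin n, (i : ℕ) = m - 1 → ψ x i = 0}

/-- A smooth partial homeomorphism with invertible derivatives that carries membership in `M` to
membership in the model set restricts to a chart. -/
lemma isChartOn_of_openPartialHomeomorph {n : ℕ} {Mod M V : Set (Euc n)}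
    (e : OpenPartialHomeomorph (Euc n) (Euc n)) (he : ContDiff ℝ (⊤ : ℕ∞) e) (hV : IsOpen V)
    (hVe : V ⊆ e.source)
    (hderiv : ∀ y ∈ V, ∃ L : Euc n ≃L[ℝ] Euc n, HasFDerivAt e (L : Euc n →L[ℝ] Euc n) y)
    (hmem : ∀ y ∈ V, y ∈ M ↔ e y ∈ Mod) : IsChartOn ⊤ Mod M V e := by
  refine ⟨hV, he.contDiffOn, e.isOpen_image_of_subset_source hV hVe, e.injOn.mono hVe,
    ⟨e.symm, ?_, fun y hy => e.left_inv (hVe hy)⟩, ?_⟩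
  · rintro _ ⟨y, hy, rfl⟩
    obtain ⟨L, hL⟩ := hderiv y hy
    refine (e.contDiffAt_symm (f₀' := L) (e.map_source (hVe hy)) ?_ ?_).contDiffWithinAt
    · rwa [e.left_inv (hVe hy)]
    · exact he.contDiffAt
  · ext z
    constructor
    · rintro ⟨y, ⟨hy, hyM⟩, rfl⟩
      exact ⟨mem_image_of_mem _ hy, (hmem y hy).1 hyM⟩
    · rintro ⟨⟨y, hy, rfl⟩, hz⟩
      exact ⟨y, ⟨hy, (hmem y hy).2 hz⟩, rfl⟩

lemma mem_halfModel_self {n : ℕ} {l : Fin n} (hl : (l : ℕ) = n - 1) (y : Euc n) :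
    y ∈ halfModel n n ↔ 0 ≤ y l := by
  constructor
  · exact fun h => h.2 l hl
  · intro h
    refine ⟨fun i hi => absurd i.2 (by omega), fun i hi => ?_⟩
    rwa [Fin.ext (hi.trans hl.symm)]

lemma exists_chart_interior {n : ℕ} {l : Fin n} (hl : (l : ℕ) = n - 1) {M : Set (Euc n)}
    {x : Euc n} (hx : x ∈ interior M) :
    ∃ V ψ, x ∈ V ∧ IsChartOn ⊤ (halfModel n n) M V ψ := by
  set w : Euc n := EuclideanSpace.single l (1 - x l)
  refine ⟨interior M ∩ {y | x l - 1 < y l}, Homeomorph.addRight w, ⟨hx, by simp⟩,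
    isChartOn_of_openPartialHomeomorph (Homeomorph.addRight w).toOpenPartialHomeomorph ?_
      (isOpen_interior.inter (isOpen_lt (by fun_prop) (by fun_prop))) (subset_univ _) ?_ ?_⟩
  · exact contDiff_id.add contDiff_const
  · exact fun y _ => ⟨ContinuousLinearEquiv.refl ℝ _, (hasFDerivAt_id y).add_const w⟩
  · rintro y ⟨hyM, hy⟩
    rw [mem_halfModel_self hl]
    refine iff_of_true (interior_subset hyM) ?_
    have hy' : x l - 1 < y l := hy
    simp [w]
    linarith

/-- Replace one coordinate by `c - F` and move it to position `l`. -/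
def straighten {n : ℕ} (F : Euc n → ℝ) (c : ℝ) (k l : Fin n) (y : Euc n) : Euc n :=
  WithLp.toLp 2 fun i => if i = l then c - F y else y (Equiv.swap k l i)

lemma hasFDerivAt_straighten {n : ℕ} {F : Euc n → ℝ} (hF : ContDiff ℝ (⊤ : ℕ∞) F) (c : ℝ)
    (k l : Fin n) {y : Euc n} (hk : fderiv ℝ F y (EuclideanSpace.single k 1) ≠ 0) :
    ∃ L : Euc n ≃L[ℝ] Euc n,
      HasFDerivAt (straighten F c k l) (L : Euc n →L[ℝ] Euc n) y := by
  have hFy : HasFDerivAt F (fderiv ℝ F y) y :=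
    (hF.differentiable (by simp) y).hasFDerivAt
  let A : Euc n →L[ℝ] Euc n :=
    (PiLp.continuousLinearEquiv 2 ℝ (fun _ : Fin n => ℝ)).symm.toContinuousLinearMap ∘L
      ContinuousLinearMap.pi fun i =>
        if i = l then -fderiv ℝ F y else EuclideanSpace.proj (Equiv.swap k l i)
  have hA : HasFDerivAt (straighten F c k l) A y := by
    rw [← hasFDerivWithinAt_univ, hasFDerivWithinAt_euclidean]
    intro i
    rw [hasFDerivWithinAt_univ]
    by_cases hi : i = l
    · subst hi
      simp only [straighten, if_true]
      refine (hFy.const_sub c).congr_fderiv ?_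
      ext v
      simp [A]
    · simp only [straighten, hi, if_false]
      refine HasFDerivAt.congr_fderiv (EuclideanSpace.proj (𝕜 := ℝ) (Equiv.swap k l i) :
        Euc n →L[ℝ] ℝ).hasFDerivAt ?_
      ext v
      simp [A, hi]
  have hAinj : Function.Injective (A : Euc n →ₗ[ℝ] Euc n) := by
    rw [← LinearMap.ker_eq_bot, LinearMap.ker_eq_bot']
    intro v hv
    have hv' : ∀ i, A v i = 0 := fun i => by
      have : A v = 0 := hv
      simp [this]
    have hne : ∀ j, j ≠ k → v j = 0 := by
      intro j hj
      have hjl : Equiv.swap k l j ≠ l := by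
        intro h
        apply hj
        have := congrArg (Equiv.swap k l) h
        simpa using this
      simpa [A, hjl] using hv' (Equiv.swap k l j)
    have hvk : v = v k • EuclideanSpace.single k (1 : ℝ) := by
      ext j
      by_cases hj : j = k
      · subst hj; simp
      · simp [hne j hj, hj]
    have h0 : fderiv ℝ F y v = 0 := by simpa [A] using hv' l
    rw [hvk, map_smul, smul_eq_mul, mul_eq_zero, or_iff_left hk] at h0
    rw [hvk, h0, zero_smul]
  refine ⟨(LinearEquiv.ofInjectiveEndo _ hAinj).toContinuousLinearEquiv, ?_⟩
  have hL : ((LinearEquiv.ofInjectiveEndo _ hAinj).toContinuousLinearEquiv :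
      Euc n →L[ℝ] Euc n) = A := by
    ext1 v
    rfl
  rwa [hL]

lemma contDiff_straighten {n : ℕ} {F : Euc n → ℝ} (hF : ContDiff ℝ (⊤ : ℕ∞) F) (c : ℝ)
    (k l : Fin n) : ContDiff ℝ (⊤ : ℕ∞) (straighten F c k l) := by
  rw [contDiff_euclidean]
  intro i
  by_cases hi : i = l
  · simpa [straighten, hi] using contDiff_const.sub hF
  · simp only [straighten, hi, if_false]
    fun_prop

lemma exists_chart_of_fderiv_ne_zero {n : ℕ} {l : Fin n} (hl : (l : ℕ) = n - 1)
    {F : Euc n → ℝ} (hF : ContDiff ℝ (⊤ : ℕ∞) F) {c : ℝ} {x : Euc n} (hx : F x = c)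
    (hd : fderiv ℝ F x ≠ 0) :
    ∃ V ψ, x ∈ V ∧ IsChartOn ⊤ (halfModel n n) {y | F y ≤ c} V ψ ∧
      ∀ i : Fin n, (i : ℕ) = n - 1 → ψ x i = 0 := by
  obtain ⟨k, hk⟩ : ∃ k, fderiv ℝ F x (EuclideanSpace.single k 1) ≠ 0 := by
    by_contra! h
    apply hd
    have : (fderiv ℝ F x : Euc n →ₗ[ℝ] ℝ) = 0 :=
      (EuclideanSpace.basisFun (Fin n) ℝ).toBasis.ext fun i => by simpa using h i
    ext v
    exact LinearMap.congr_fun this v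
  obtain ⟨L, hL⟩ := hasFDerivAt_straighten hF c k l hk
  have hs : HasStrictFDerivAt (straighten F c k l) (L : Euc n →L[ℝ] Euc n) x :=
    (contDiff_straighten hF c k l).contDiffAt.hasStrictFDerivAt' hL (by simp)
  set e := hs.toOpenPartialHomeomorph (straighten F c k l)
  have hcont : Continuous fun y => fderiv ℝ F y (EuclideanSpace.single k 1) :=
    (hF.continuous_fderiv (by simp)).clm_apply continuous_const
  refine ⟨e.source ∩ {y | fderiv ℝ F y (EuclideanSpace.single k 1) ≠ 0}, e,
    ⟨hs.mem_toOpenPartialHomeomorph_source, hk⟩,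
    isChartOn_of_openPartialHomeomorph e (contDiff_straighten hF c k l)
      (e.open_source.inter (isOpen_ne_fun hcont continuous_const)) inter_subset_left
      (fun y hy => hasFDerivAt_straighten hF c k l hy.2) fun y _ => ?_, fun i hi => ?_⟩
  · rw [mem_halfModel_self hl]
    change F y ≤ c ↔ 0 ≤ straighten F c k l y l
    simp [straighten]
  · change straighten F c k l x i = 0
    simp [straighten, Fin.ext (hi.trans hl.symm), hx]

lemma mfdBoundary_subset_frontier {n : ℕ} (hn : 0 < n) {M : Set (Euc n)} :
    mfdBoundary ⊤ n M ⊆ frontier M := by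
  rintro x ⟨hxM, V, ψ, hxV, ⟨hV, -, hψV, -, ⟨φ, hφ, hleft⟩, him⟩, h0⟩
  refine ⟨subset_closure hxM, fun h_interior => ?_⟩
  set l : Fin n := ⟨n - 1, by omega⟩
  have hcont : ContinuousAt φ (ψ x) :=
    hφ.continuousOn.continuousAt (hψV.mem_nhds (mem_image_of_mem _ hxV))
  have hnhds : ∀ᶠ z in 𝓝 (ψ x), 0 ≤ z l := by
    have h1 : ∀ᶠ z in 𝓝 (ψ x), φ z ∈ M :=
      hcont (by rw [hleft x hxV]; exact mem_interior_iff_mem_nhds.1 h_interior)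
    filter_upwards [h1, hψV.mem_nhds (mem_image_of_mem _ hxV)] with z hz hzV
    obtain ⟨y, hy, rfl⟩ := hzV
    rw [hleft y hy] at hz
    exact (him.subset (mem_image_of_mem ψ ⟨hy, hz⟩)).2.2 l rfl
  have hlim : Filter.Tendsto (fun t : ℝ => ψ x - t • EuclideanSpace.single l (1 : ℝ)) (𝓝[>] 0)
      (𝓝 (ψ x)) := by
    have hc : Continuous fun t : ℝ => ψ x - t • EuclideanSpace.single l (1 : ℝ) := by fun_prop
    simpa using (hc.tendsto 0).mono_left nhdsWithin_le_nhds
  obtain ⟨t, ht, htpos⟩ := ((hlim.eventually hnhds).and self_mem_nhdsWithin).exists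
  have htpos' : 0 < t := htpos
  simp [h0 l rfl] at ht
  linarith

lemma ConvexOn.fderiv_ne_zero_of_lt {E : Type*} [NormedAddCommGroup E] [NormedSpace ℝ E]
    {F : E → ℝ} (hF : ConvexOn ℝ univ F) {x m : E} (hd : DifferentiableAt ℝ F x)
    (hlt : F m < F x) : fderiv ℝ F x ≠ 0 := by
  intro h0
  have hline : HasDerivAt (fun t : ℝ => F (AffineMap.lineMap x m t)) 0 0 := by
    have h1 : HasFDerivAt F (fderiv ℝ F x) (AffineMap.lineMap x m (0 : ℝ)) := by
      simpa using hd.hasFDerivAt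
    have h2 := h1.comp_hasDerivAt (0 : ℝ) AffineMap.hasDerivAt_lineMap
    rw [h0, zero_apply] at h2
    exact h2
  have hconv : ConvexOn ℝ univ (fun t : ℝ => F (AffineMap.lineMap x m t)) :=
    hF.comp_affineMap (AffineMap.lineMap x m)
  have := hconv.le_slope_of_hasDerivAt (mem_univ 0) (mem_univ 1) one_pos hline
  simp [slope_def_field] at this
  linarith

/-- Bounded sublevel sets of smooth convex functions are smooth domains with connected boundary. -/
lemma sublevel_convex {n : ℕ} (hn : 2 ≤ n) {F : Euc n → ℝ} (hF : ContDiff ℝ (⊤ : ℕ∞) F)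
    (hconv : ConvexOn ℝ univ F) {c : ℝ} {m : Euc n} (hm : F m < c)
    (hb : Bornology.IsBounded {x | F x ≤ c}) :
    IsSubmanifoldBdry ⊤ n {x | F x ≤ c} ∧ IsClosed {x | F x ≤ c} ∧
      IsConnected (mfdBoundary ⊤ n {x | F x ≤ c}) := by
  set l : Fin n := ⟨n - 1, by omega⟩
  have hchart : ∀ x, F x = c → ∃ V ψ, x ∈ V ∧
      IsChartOn ⊤ (halfModel n n) {y | F y ≤ c} V ψ ∧
      ∀ i : Fin n, (i : ℕ) = n - 1 → ψ x i = 0 := fun x hx =>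
    exists_chart_of_fderiv_ne_zero (l := l) rfl hF hx
      (hconv.fderiv_ne_zero_of_lt (hF.differentiable (by simp) x) (hx ▸ hm))
  have h_interior : {x | F x < c} ⊆ interior {x | F x ≤ c} :=
    interior_maximal (fun x (hx : F x < c) => hx.le) (isOpen_lt hF.continuous continuous_const)
  have hcl : IsClosed {x | F x ≤ c} := isClosed_le hF.continuous continuous_const
  have hbd : mfdBoundary ⊤ n {x | F x ≤ c} = frontier {x | F x ≤ c} := by
    refine (mfdBoundary_subset_frontier (by omega)).antisymm fun x hx => ?_
    have hxM : F x ≤ c := hcl.frontier_subset hx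
    exact ⟨hxM, hchart x (hxM.eq_of_not_lt fun h => hx.2 (h_interior h))⟩
  refine ⟨fun x hx => ?_, hcl, ?_⟩
  · rcases lt_or_eq_of_le (show F x ≤ c from hx) with h | h
    · exact exists_chart_interior (l := l) rfl (h_interior h)
    · obtain ⟨V, ψ, hxV, hψ, -⟩ := hchart x h
      exact ⟨V, ψ, hxV, hψ⟩
  · have hcM : Convex ℝ {x | F x ≤ c} := by simpa using hconv.convex_le c
    obtain ⟨h, -, -, hfr⟩ := exists_homeomorph_image_interior_closure_frontier_eq_unitBall hcM
      ⟨m, h_interior hm⟩ hb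
    have hsph : IsConnected (sphere (0 : Euc n) 1) := by
      refine isConnected_sphere ?_ 0 zero_le_one
      rw [← Module.finrank_eq_rank, finrank_euclideanSpace_fin]
      exact_mod_cast hn
    rw [hbd]
    rwa [← hfr, h.isConnected_image] at hsph

lemma exists_smooth_convex_ramp : ∃ G : ℝ → ℝ, ContDiff ℝ (⊤ : ℕ∞) G ∧ ConvexOn ℝ univ G ∧
    (∀ t ≤ 0, G t = 0) ∧ StrictMonoOn G (Ici 0) := by
  have hE : ContDiff ℝ (⊤ : ℕ∞) expNegInvGlue := expNegInvGlue.contDiff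
  have hder : ∀ t, HasDerivAt (fun t => ∫ s in (0 : ℝ)..t, expNegInvGlue s)
      (expNegInvGlue t) t := fun t =>
    intervalIntegral.integral_hasDerivAt_right (hE.continuous.intervalIntegrable _ _)
      hE.continuous.stronglyMeasurable.stronglyMeasurableAtFilter hE.continuous.continuousAt
  have hdiff : Differentiable ℝ (fun t => ∫ s in (0 : ℝ)..t, expNegInvGlue s) :=
    fun t => (hder t).differentiableAt
  have hderiv : deriv (fun t => ∫ s in (0 : ℝ)..t, expNegInvGlue s) = expNegInvGlue :=
    funext fun t => (hder t).deriv
  refine ⟨fun t => ∫ s in (0 : ℝ)..t, expNegInvGlue s, ?_, ?_, ?_, ?_⟩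
  · exact contDiff_infty_iff_deriv.2 ⟨hdiff, by rwa [hderiv]⟩
  · exact Monotone.convexOn_univ_of_deriv hdiff (by rw [hderiv]; exact expNegInvGlue.monotone)
  · intro t ht
    refine (intervalIntegral.integral_congr (g := fun _ => 0) fun s hs => ?_).trans (by simp)
    rw [uIcc_of_ge ht] at hs
    exact expNegInvGlue.zero_of_nonpos hs.2
  · refine strictMonoOn_of_deriv_pos (convex_Ici 0) hdiff.continuous.continuousOn fun t ht => ?_
    rw [hderiv]
    rw [interior_Ici] at ht
    exact expNegInvGlue.pos_of_pos ht

/-- **smoothing the corners of a box.** Let `n ≥ 2`, `a_k < b_k` for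
`k = 1, …, n`, `ε > 0`, `Q` the closed box `{x : a_k ≤ x_k ≤ b_k}`, `S` the set of points
of `Q` lying on at least two faces, and `U = Q ∩ {x : dist(x,S) < ε}`.  Then there is a
properly embedded `n`-dimensional `C^∞` submanifold-with-boundary `M` of `ℝⁿ` such that
`∂M` is connected and `M ∖ U = Q ∖ U`. -/
theorem smoothing_of_box_corners (n : ℕ) (hn : 2 ≤ n) (a b : Fin n → ℝ)
    (hab : ∀ k, a k < b k) (ε : ℝ) (hε : 0 < ε) (Q S U : Set (Euc n))
    (hQ : Q = {x | ∀ k : Fin n, a k ≤ x k ∧ x k ≤ b k})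
    (hS : S = Q ∩ {x | 2 ≤ {k : Fin n | x k = a k ∨ x k = b k}.ncard})
    (hU : U = Q ∩ {x | Metric.infDist x S < ε}) :
    ∃ M : Set (Euc n), IsSubmanifoldBdry ⊤ n M ∧ IsClosed M ∧
      IsConnected (mfdBoundary ⊤ n M) ∧ M \ U = Q \ U := by
  obtain ⟨G, hG, hGc, hG0, hGm⟩ := exists_smooth_convex_ramp
  have hGpos : ∀ t, 0 < t → 0 < G t := fun t ht => by
    simpa [hG0 0 le_rfl] using hGm self_mem_Ici ht.le ht
  have hGnn : ∀ t, 0 ≤ G t := fun t => by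
    rcases le_or_gt t 0 with h | h
    · rw [hG0 t h]
    · exact (hGpos t h).le
  obtain ⟨δ, hδ, hδε, hδab⟩ : ∃ δ > 0, 2 * δ ≤ ε ∧ ∀ k, 2 * δ < b k - a k := by
    have hsmall : ∀ᶠ δ in 𝓝[>] (0 : ℝ), ∀ k, 2 * δ < b k - a k := by
      rw [Filter.eventually_all]
      intro k
      filter_upwards [Ioo_mem_nhdsGT (show (0 : ℝ) < (b k - a k) / 2 by linarith [hab k])]
        with δ hδ
      linarith [hδ.2]
    obtain ⟨δ, ⟨h1, h2⟩, h3⟩ :=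
      (hsmall.and (Ioc_mem_nhdsGT (show (0 : ℝ) < ε / 2 by linarith))).exists
        |>.imp fun δ h => (⟨⟨h.2.1, h.2.2⟩, h.1⟩ : (0 < δ ∧ δ ≤ ε / 2) ∧ _)
    exact ⟨δ, h1, by linarith, h3⟩
  let g : Fin n → ℝ → ℝ := fun k t => G (t - b k + δ) + G (a k + δ - t)
  let F : Euc n → ℝ := fun x => ∑ k, g k (x k)
  have hgnn : ∀ k t, 0 ≤ g k t := fun k t => add_nonneg (hGnn _) (hGnn _)
  have hGle : ∀ t ≤ δ, G t ≤ G δ := fun t ht => by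
    rcases le_or_gt t 0 with h | h
    · rw [hG0 t h]; exact hGnn δ
    · exact hGm.monotoneOn h.le hδ.le ht
  have hgle : ∀ k t, a k ≤ t → t ≤ b k → g k t ≤ G δ := by
    intro k t h1 h2
    have := hδab k
    rcases le_or_gt (t - b k + δ) 0 with h | h
    · simpa [g, hG0 _ h] using hGle (a k + δ - t) (by linarith)
    · simpa [g, hG0 (a k + δ - t) (by linarith)] using hGle (t - b k + δ) (by linarith)
  have hgzero : ∀ k t, 0 < g k t → t < a k + δ ∨ b k - δ < t := by
    intro k t h
    by_contra! hcon
    simp [g, hG0 (t - b k + δ) (by linarith), hG0 (a k + δ - t) (by linarith)] at h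
  have hMQ : {x | F x ≤ G δ} ⊆ Q := by
    rw [hQ]
    intro x hx k
    have hk : g k (x k) ≤ G δ :=
      (Finset.single_le_sum (fun i _ => hgnn i (x i)) (Finset.mem_univ k)).trans hx
    constructor
    · by_contra! h
      have := hGm hδ.le (show (0 : ℝ) ≤ a k + δ - x k by linarith)
        (show δ < a k + δ - x k by linarith)
      linarith [hGnn (x k - b k + δ)]
    · by_contra! h
      have := hGm hδ.le (show (0 : ℝ) ≤ x k - b k + δ by linarith)
        (show δ < x k - b k + δ by linarith)
      linarith [hGnn (a k + δ - x k)]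
  have hQM : Q \ {x | F x ≤ G δ} ⊆ U := by
    rintro x ⟨hxQ, hxM⟩
    have hx : G δ < ∑ k, g k (x k) := not_le.1 hxM
    have hxab : ∀ k, a k ≤ x k ∧ x k ≤ b k := by rw [hQ] at hxQ; exact hxQ
    obtain ⟨i, -, hi⟩ : ∃ i ∈ Finset.univ, 0 < g i (x i) :=
      Finset.exists_lt_of_sum_lt (by simpa using (hGnn δ).trans_lt hx)
    obtain ⟨j, hj, hgj⟩ : ∃ j ∈ Finset.univ.erase i, 0 < g j (x j) := by
      refine Finset.exists_lt_of_sum_lt ?_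
      rw [← Finset.add_sum_erase _ _ (Finset.mem_univ i)] at hx
      simp only [Finset.sum_const_zero]
      linarith [hgle i (x i) (hxab i).1 (hxab i).2]
    have hface : ∀ k, 0 < g k (x k) → ∃ s, (s = a k ∨ s = b k) ∧ |s - x k| < δ := by
      intro k hk
      rcases hgzero k _ hk with h | h
      · exact ⟨a k, .inl rfl, by rw [abs_lt]; constructor <;> linarith [hxab k]⟩
      · exact ⟨b k, .inr rfl, by rw [abs_lt]; constructor <;> linarith [hxab k]⟩
    obtain ⟨s, hs, hsx⟩ := hface i hi
    obtain ⟨t, ht, htx⟩ := hface j hgj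
    have hji : j ≠ i := Finset.ne_of_mem_erase hj
    set w : Euc n := EuclideanSpace.single i (s - x i) + EuclideanSpace.single j (t - x j)
    have hwi : (x + w) i = s := by simp [w, hji.symm]
    have hwj : (x + w) j = t := by simp [w, hji]
    have hwS : x + w ∈ S := by
      rw [hS, hQ]
      constructor
      · intro k
        by_cases hki : k = i
        · subst hki
          rw [hwi]
          rcases hs with rfl | rfl <;> simp [(hab _).le]
        by_cases hkj : k = j
        · subst hkj
          rw [hwj]
          rcases ht with rfl | rfl <;> simp [(hab _).le]
        · simpa [w, hki, hkj] using hxab k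
      · change 2 ≤ ncard _
        rw [← ncard_pair hji.symm]
        refine ncard_le_ncard ?_ (toFinite _)
        rintro k (rfl | rfl)
        · simpa only [mem_ofPred_eq, hwi] using hs
        · simpa only [mem_ofPred_eq, hwj] using ht
    rw [hU]
    refine ⟨hxQ, (infDist_le_dist_of_mem hwS).trans_lt ?_⟩
    rw [dist_self_add_right]
    have hnorm := norm_add_le (EuclideanSpace.single i (s - x i) : Euc n)
      (EuclideanSpace.single j (t - x j))
    simp only [PiLp.norm_single, Real.norm_eq_abs] at hnorm
    change ‖w‖ ≤ _ at hnorm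
    linarith
  have hb : Bornology.IsBounded {x | F x ≤ G δ} := by
    refine Bornology.IsBounded.subset ?_ hMQ
    have hcomp : IsCompact ((WithLp.ofLp : Euc n → Fin n → ℝ) ⁻¹' Icc a b) :=
      (EuclideanSpace.equiv (Fin n) ℝ).toHomeomorph.isCompact_preimage.2 isCompact_Icc
    refine hcomp.isBounded.subset fun x hx => ?_
    rw [hQ] at hx
    exact ⟨fun k => (hx k).1, fun k => (hx k).2⟩
  have hF : ContDiff ℝ (⊤ : ℕ∞) F := by
    refine ContDiff.sum fun k _ => ContDiff.add (hG.comp ?_) (hG.comp ?_) <;> fun_prop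
  have hFc : ConvexOn ℝ univ F := by
    have hgc : ∀ k, ConvexOn ℝ univ (g k) := by
      intro k
      refine ConvexOn.add ?_ ?_
      · simpa [Function.comp_def, sub_add_eq_add_sub, add_sub_assoc] using hGc.comp_affineMap
          (AffineMap.id ℝ ℝ + AffineMap.const ℝ ℝ (δ - b k))
      · simpa [Function.comp_def] using hGc.comp_affineMap
          (AffineMap.const ℝ ℝ (a k + δ) - AffineMap.id ℝ ℝ)
    refine ⟨convex_univ, fun x _ y _ p q hp hq hpq => ?_⟩
    simp only [F, Finset.smul_sum, ← Finset.sum_add_distrib]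
    exact Finset.sum_le_sum fun k _ => (hgc k).2 (mem_univ (x k)) (mem_univ (y k)) hp hq hpq
  have hm : F (WithLp.toLp 2 fun k => (a k + b k) / 2) < G δ := by
    have : F (WithLp.toLp 2 fun k => (a k + b k) / 2) = 0 := by
      refine Finset.sum_eq_zero fun k _ => ?_
      have := hδab k
      simp only [g]
      rw [hG0 _ (by linarith), hG0 _ (by linarith), add_zero]
    rw [this]
    exact hGpos δ hδ
  obtain ⟨h1, h2, h3⟩ := sublevel_convex hn hF hFc hm hb
  refine ⟨_, h1, h2, h3, ?_⟩
  ext x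
  constructor
  · exact fun h => ⟨hMQ h.1, h.2⟩
  · exact fun h => ⟨by_contra fun hx => h.2 (hQM ⟨h.1, hx⟩), h.2⟩

end
end
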